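/- For every 1 ≤ q < 2 there exists a constant C_q > 0 (depending only on q) such that for every weighted graph G = (V,E,w) on n ≥ 2 vertices and every parameter 0 < ρ < 1, there exists a spanning tree T of G with lightness Ψ(T) ≤ 1 + ρ and ℓ_q-distortion dist_q(T,G) ≤ C_q/ρ. -/

import Mathlib

open Finset

attribute [local instance] Classical.propDecidable

section Defs

variable {V : Type*} [Fintype V]

/-- Total weight of a (sub)graph: the sum of its edge weights. -/
noncomputable def wWeight (H : SimpleGraph V) (w : Sym2 V → ℝ) : ℝ :=
  ∑ e ∈ H.edgeSet.toFinite.toFinset, w e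

/-- Shortest-path distance in a weighted graph: infimum of walk weights. -/
noncomputable def wdist (G : SimpleGraph V) (w : Sym2 V → ℝ) (u v : V) : ℝ :=
  sInf {x : ℝ | ∃ p : G.Walk u v, x = (p.edges.map w).sum}

/-- `T` is a spanning tree of `G`. -/
def IsSpanningTree (G T : SimpleGraph V) : Prop :=
  T ≤ G ∧ T.IsTree

/-- Weight of a minimum spanning tree of `G`. -/
noncomputable def mstWeight (G : SimpleGraph V) (w : Sym2 V → ℝ) : ℝ :=
  sInf {x : ℝ | ∃ T : SimpleGraph V, IsSpanningTree G T ∧ x = wWeight T w}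

/-- `T` is a minimum spanning tree of `G`. -/
def IsMST (G : SimpleGraph V) (w : Sym2 V → ℝ) (T : SimpleGraph V) : Prop :=
  IsSpanningTree G T ∧ ∀ T' : SimpleGraph V, IsSpanningTree G T' → wWeight T w ≤ wWeight T' w

/-- A spanner of `G`: a connected spanning subgraph. -/
def IsSpanner (G H : SimpleGraph V) : Prop := H ≤ G ∧ H.Connected

/-- `G` together with `w` is a weighted graph: connected, positive pairwise-distinct
edge weights. -/
def IsWeightedGraph (G : SimpleGraph V) (w : Sym2 V → ℝ) : Prop :=
  G.Connected ∧ (∀ e ∈ G.edgeSet, 0 < w e) ∧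
    (∀ e ∈ G.edgeSet, ∀ e' ∈ G.edgeSet, e ≠ e' → w e ≠ w e')

/-- The ordered pairs of distinct vertices whose distortion in `H` is at most `t`. -/
noncomputable def goodPairs (G H : SimpleGraph V) (w : Sym2 V → ℝ) (t : ℝ) : Finset (V × V) :=
  Finset.univ.offDiag.filter (fun p => wdist H w p.1 p.2 ≤ t * wdist G w p.1 p.2)

/-- Scaling distortion `γ`: for every `ε ∈ (0,1)`, at least a `(1-ε)` fraction of the
pairs of distinct vertices have distortion at most `γ ε`.  (Counted over ordered pairs:
`n·(n-1) = 2·(n choose 2)`.) -/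
def HasScalingDistortion (G H : SimpleGraph V) (w : Sym2 V → ℝ) (γ : ℝ → ℝ) : Prop :=
  ∀ ε : ℝ, 0 < ε → ε < 1 →
    (1 - ε) * ((Fintype.card V : ℝ) * ((Fintype.card V : ℝ) - 1)) ≤
      ((goodPairs G H w (γ ε)).card : ℝ)

/-- The `ℓ_q`-distortion of the spanner `H` of `G`. -/
noncomputable def distq (G H : SimpleGraph V) (w : Sym2 V → ℝ) (q : ℝ) : ℝ :=
  ((∑ p ∈ (Finset.univ : Finset V).offDiag, (wdist H w p.1 p.2 / wdist G w p.1 p.2) ^ q) /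
    ((Fintype.card V : ℝ) * ((Fintype.card V : ℝ) - 1))) ^ (1 / q)

/-- `R(v,ε)`: the minimal radius `r` such that the ball `B(v,r)` contains at least `εn`
vertices. -/
noncomputable def Rgraph (G : SimpleGraph V) (w : Sym2 V → ℝ) (v : V) (ε : ℝ) : ℝ :=
  sInf {r : ℝ | 0 ≤ r ∧
    ε * (Fintype.card V : ℝ) ≤ ((Finset.univ.filter (fun u => wdist G w u v ≤ r)).card : ℝ)}

/-- Coarse scaling distortion `γ`: every pair of distinct vertices that are mutually
`ε/2`-far has distortion at most `γ ε`. -/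
def HasCoarseScalingDistortion (G H : SimpleGraph V) (w : Sym2 V → ℝ) (γ : ℝ → ℝ) : Prop :=
  ∀ ε : ℝ, 0 < ε → ε < 1 → ∀ u v : V, u ≠ v →
    Rgraph G w v (ε / 2) ≤ wdist G w u v → Rgraph G w u (ε / 2) ≤ wdist G w u v →
    wdist H w u v ≤ γ ε * wdist G w u v

end Defs

section Basics

variable {V : Type*}

/-- Some walk in `G` from `u` to `v` has total weight at most `t`. -/
def ReachWithin (G : SimpleGraph V) (w : Sym2 V → ℝ) (u v : V) (t : ℝ) : Prop :=
  ∃ p : G.Walk u v, (p.edges.map w).sum ≤ t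

namespace ReachWithin

variable {G H : SimpleGraph V} {w w' : Sym2 V → ℝ} {u v x : V} {s t : ℝ}

theorem refl (G : SimpleGraph V) (w : Sym2 V → ℝ) (u : V) (ht : 0 ≤ t) :
    ReachWithin G w u u t := ⟨.nil, by simpa using ht⟩

theorem mono (h : ReachWithin G w u v s) (hst : s ≤ t) : ReachWithin G w u v t :=
  let ⟨p, hp⟩ := h
  ⟨p, hp.trans hst⟩

theorem of_le (h : ReachWithin G w u v s) (hGH : G ≤ H) : ReachWithin H w u v s :=
  let ⟨p, hp⟩ := h
  ⟨p.mapLe hGH, by rwa [SimpleGraph.Walk.edges_mapLe_eq_edges]⟩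

theorem trans (h : ReachWithin G w u v s) (h' : ReachWithin G w v x t) :
    ReachWithin G w u x (s + t) :=
  let ⟨p, hp⟩ := h
  let ⟨p', hp'⟩ := h'
  ⟨p.append p', by simpa using add_le_add hp hp'⟩

theorem symm (h : ReachWithin G w u v s) : ReachWithin G w v u s :=
  let ⟨p, hp⟩ := h
  ⟨p.reverse, by simpa using hp⟩

theorem of_adj (h : G.Adj u v) : ReachWithin G w u v (w s(u, v)) :=
  ⟨.cons h .nil, by simp⟩

theorem reachable (h : ReachWithin G w u v s) : G.Reachable u v :=
  let ⟨p, _⟩ := h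
  ⟨p⟩

theorem mono_weight (h : ReachWithin G w u v s) (hw : ∀ e ∈ G.edgeSet, w' e ≤ w e) :
    ReachWithin G w' u v s :=
  let ⟨p, hp⟩ := h
  ⟨p, (List.sum_le_sum fun e he => hw e (p.edges_subset_edgeSet he)).trans hp⟩

end ReachWithin

variable {G : SimpleGraph V} {w : Sym2 V → ℝ}

theorem walk_weight_nonneg (hw : ∀ e ∈ G.edgeSet, 0 < w e) {u v : V} (p : G.Walk u v) :
    0 ≤ (p.edges.map w).sum := by
  apply List.sum_nonneg
  intro x hx
  obtain ⟨e, he, rfl⟩ := List.mem_map.1 hx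
  exact (hw e (p.edges_subset_edgeSet he)).le

theorem ReachWithin.nonneg (hw : ∀ e ∈ G.edgeSet, 0 < w e) {u v : V} {t : ℝ}
    (h : ReachWithin G w u v t) : 0 ≤ t :=
  let ⟨p, hp⟩ := h
  (walk_weight_nonneg hw p).trans hp

theorem wdist_le_of_reachWithin (hw : ∀ e ∈ G.edgeSet, 0 < w e) {u v : V} {t : ℝ}
    (h : ReachWithin G w u v t) : wdist G w u v ≤ t := by
  obtain ⟨p, hp⟩ := h
  have hb : BddBelow {x : ℝ | ∃ p : G.Walk u v, x = (p.edges.map w).sum} := by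
    refine ⟨0, ?_⟩
    rintro x ⟨p, rfl⟩
    exact walk_weight_nonneg hw p
  exact (csInf_le hb ⟨p, rfl⟩).trans hp

theorem wdist_nonneg (hw : ∀ e ∈ G.edgeSet, 0 < w e) (u v : V) : 0 ≤ wdist G w u v := by
  apply Real.sInf_nonneg
  rintro x ⟨p, rfl⟩
  exact walk_weight_nonneg hw p

theorem wdist_comm (G : SimpleGraph V) (w : Sym2 V → ℝ) (u v : V) :
    wdist G w u v = wdist G w v u := by
  unfold wdist
  congr 1
  ext x
  constructor
  · rintro ⟨p, rfl⟩
    exact ⟨p.reverse, by simp⟩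
  · rintro ⟨p, rfl⟩
    exact ⟨p.reverse, by simp⟩

theorem wdist_self (hw : ∀ e ∈ G.edgeSet, 0 < w e) (u : V) : wdist G w u u = 0 :=
  le_antisymm (wdist_le_of_reachWithin hw (.refl G w u le_rfl)) (wdist_nonneg hw u u)

end Basics

section Distance

variable {V : Type*} [Fintype V] {G : SimpleGraph V} {w : Sym2 V → ℝ}

theorem reachWithin_wdist (hw : ∀ e ∈ G.edgeSet, 0 < w e) {u v : V} (h : G.Reachable u v) :
    ReachWithin G w u v (wdist G w u v) := by
  obtain ⟨p₀⟩ := h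
  have hfin : (Set.range fun p : G.Path u v => ((p : G.Walk u v).edges.map w).sum).Finite := by
    have : Finite (G.Path u v) := Finite.of_fintype _
    exact Set.finite_range _
  obtain ⟨x, ⟨p, rfl⟩, hmin⟩ := hfin.exists_minimal
    (Set.range_nonempty_iff_nonempty.2 ⟨p₀.toPath⟩)
  refine ⟨p, le_csInf ⟨_, p₀, rfl⟩ ?_⟩
  rintro x ⟨p', rfl⟩
  have h1 : ((p'.bypass).edges.map w).sum ≤ (p'.edges.map w).sum := by
    apply ((p'.edges_bypass_sublist_edges).map w).sum_le_sum
    intro x hx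
    obtain ⟨e, he, rfl⟩ := List.mem_map.1 hx
    exact (hw e (p'.edges_subset_edgeSet he)).le
  have h2 : ((p : G.Walk u v).edges.map w).sum ≤ ((p'.bypass).edges.map w).sum := by
    rcases le_total ((p : G.Walk u v).edges.map w).sum ((p'.bypass).edges.map w).sum with h | h
    · exact h
    · exact hmin ⟨p'.toPath, rfl⟩ h
  exact h2.trans h1

theorem wdist_triangle_of_reachable (hw : ∀ e ∈ G.edgeSet, 0 < w e) {u v x : V}
    (h : G.Reachable u v) (h' : G.Reachable v x) :
    wdist G w u x ≤ wdist G w u v + wdist G w v x :=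
  wdist_le_of_reachWithin hw ((reachWithin_wdist hw h).trans (reachWithin_wdist hw h'))

theorem wdist_le_add_of_adj (hw : ∀ e ∈ G.edgeSet, 0 < w e) {p a b : V}
    (h : G.Reachable p a) (hab : G.Adj a b) :
    wdist G w p b ≤ wdist G w p a + w s(a, b) :=
  wdist_le_of_reachWithin hw ((reachWithin_wdist hw h).trans (.of_adj hab))

theorem exists_adj_wdist_eq (hw : ∀ e ∈ G.edgeSet, 0 < w e) {p z : V}
    (h : G.Reachable p z) (hne : z ≠ p) :
    ∃ y, G.Adj y z ∧ G.Reachable p y ∧ wdist G w p z = wdist G w p y + w s(y, z) := by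
  obtain ⟨W, hW⟩ := reachWithin_wdist hw h
  induction W using SimpleGraph.Walk.concatRec with
  | Hnil => exact absurd rfl hne
  | @Hconcat u y z W' hadj _ =>
    have hr : G.Reachable u y := ⟨W'⟩
    refine ⟨y, hadj, hr, le_antisymm (wdist_le_add_of_adj hw hr hadj) ?_⟩
    rw [SimpleGraph.Walk.edges_concat] at hW
    have := wdist_le_of_reachWithin hw ⟨W', le_rfl⟩
    simp at hW
    linarith

theorem wdist_pos (hw : ∀ e ∈ G.edgeSet, 0 < w e) {u v : V} (h : G.Reachable u v)
    (hne : u ≠ v) : 0 < wdist G w u v := by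
  obtain ⟨y, hy, -, he⟩ := exists_adj_wdist_eq hw h hne.symm
  have := hw s(y, v) hy
  have := wdist_nonneg hw u y
  linarith

end Distance

section Weight

variable {V : Type*} [Fintype V] {w : Sym2 V → ℝ}

theorem wWeight_nonneg {H : SimpleGraph V} (hw : ∀ e ∈ H.edgeSet, 0 < w e) :
    0 ≤ wWeight H w :=
  Finset.sum_nonneg fun e he => (hw e (by simpa using he)).le

theorem wWeight_mono {H K : SimpleGraph V} (hw : ∀ e ∈ K.edgeSet, 0 < w e) (h : H ≤ K) :
    wWeight H w ≤ wWeight K w := by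
  apply Finset.sum_le_sum_of_subset_of_nonneg
  · intro e he
    simp only [Set.Finite.mem_toFinset] at he ⊢
    exact SimpleGraph.edgeSet_mono h he
  · intro e he _
    exact (hw e (by simpa using he)).le

theorem wWeight_sup_le {H K : SimpleGraph V} (hH : ∀ e ∈ H.edgeSet, 0 < w e) :
    wWeight (H ⊔ K) w ≤ wWeight H w + wWeight K w := by
  unfold wWeight
  have : (H ⊔ K).edgeSet.toFinite.toFinset =
      H.edgeSet.toFinite.toFinset ∪ K.edgeSet.toFinite.toFinset := by
    ext e; simp
  rw [this, ← Finset.sum_union_inter]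
  have : 0 ≤ ∑ e ∈ H.edgeSet.toFinite.toFinset ∩ K.edgeSet.toFinite.toFinset, w e :=
    Finset.sum_nonneg fun e he => (hH e (by simpa using (Finset.mem_inter.1 he).1)).le
  linarith

theorem wWeight_bot : wWeight (⊥ : SimpleGraph V) w = 0 := by
  simp [wWeight]

theorem wWeight_edge_le {u v : V} (h : 0 ≤ w s(u, v)) :
    wWeight (SimpleGraph.edge u v) w ≤ w s(u, v) := by
  unfold wWeight
  calc _ ≤ ∑ e ∈ {s(u, v)}, w e := by
        apply Finset.sum_le_sum_of_subset_of_nonneg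
        · intro e he
          simp [SimpleGraph.edgeSet_edge] at he
          simp [he.1]
        · simp [h]
    _ = _ := by simp

theorem wWeight_walk_le {G : SimpleGraph V} (hw : ∀ e ∈ G.edgeSet, 0 < w e) {u v : V}
    (p : G.Walk u v) :
    ∃ K ≤ G, wWeight K w ≤ (p.edges.map w).sum ∧ ReachWithin K w u v (p.edges.map w).sum := by
  induction p with
  | nil => exact ⟨⊥, bot_le, by simp [wWeight_bot], .refl _ _ _ (by simp)⟩
  | @cons a b c h p ih =>
    obtain ⟨K, hK, h1, h2⟩ := ih
    have hE : SimpleGraph.edge a b ≤ G := by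
      rw [SimpleGraph.edge_le_iff]; exact Or.inr h
    refine ⟨SimpleGraph.edge a b ⊔ K, sup_le hE hK, ?_, ?_⟩
    · refine (wWeight_sup_le fun e he => hw e (SimpleGraph.edgeSet_mono hE he)).trans ?_
      have := wWeight_edge_le (w := w) (hw s(a, b) h).le
      simp
      linarith
    · have : ReachWithin (SimpleGraph.edge a b ⊔ K) w a b (w s(a, b)) :=
        .of_adj (Or.inl ((SimpleGraph.edge_adj _ _ _ _).2 ⟨Or.inl ⟨rfl, rfl⟩, h.ne⟩))
      simpa using this.trans (h2.of_le le_sup_right)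

/-- Finitely many connections of prescribed lengths can be bought for the sum of the lengths. -/
theorem exists_subgraph_of_reachWithin {G : SimpleGraph V} (hw : ∀ e ∈ G.edgeSet, 0 < w e)
    {ι : Type*} (P : Finset ι) (a b : ι → V) (s : ι → ℝ)
    (h : ∀ i ∈ P, ReachWithin G w (a i) (b i) (s i)) :
    ∃ K ≤ G, wWeight K w ≤ ∑ i ∈ P, s i ∧ ∀ i ∈ P, ReachWithin K w (a i) (b i) (s i) := by
  induction P using Finset.induction_on with
  | empty => exact ⟨⊥, bot_le, by simp [wWeight_bot], by simp⟩
  | insert i P hi ih =>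
    obtain ⟨K, hK, h1, h2⟩ := ih fun j hj => h j (mem_insert_of_mem hj)
    obtain ⟨p, hp⟩ := h i (mem_insert_self _ _)
    obtain ⟨K', hK', h3, h4⟩ := wWeight_walk_le hw p
    refine ⟨K' ⊔ K, sup_le hK' hK, ?_, ?_⟩
    · refine (wWeight_sup_le fun e he => hw e (SimpleGraph.edgeSet_mono hK' he)).trans ?_
      rw [sum_insert hi]
      linarith
    · intro j hj
      rcases mem_insert.1 hj with rfl | hj
      · exact (h4.mono hp).of_le le_sup_left
      · exact (h2 j hj).of_le le_sup_right

end Weight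

section Tour

variable {V : Type*} [Fintype V] {w : Sym2 V → ℝ}

/-- Vertices of a connected graph can be laid out on an interval of length twice the total weight
so that the graph distance is dominated by the distance on the line. -/
theorem exists_tour {T : SimpleGraph V} (hT : T.Connected) (hw : ∀ e ∈ T.edgeSet, 0 < w e)
    (s : V) :
    ∃ t : V → ℝ, t s = 0 ∧ (∀ x, 0 ≤ t x) ∧ (∀ x, t x ≤ 2 * wWeight T w) ∧
      ∀ x y, ReachWithin T w x y |t x - t y| := by
  let Good : Finset V → Prop := fun C => s ∈ C ∧ ∃ (t : V → ℝ) (F : Finset (Sym2 V)),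
    F ⊆ T.edgeSet.toFinite.toFinset ∧ (∀ e ∈ F, ∀ x ∈ e, x ∈ C) ∧ t s = 0 ∧
      (∀ x ∈ C, 0 ≤ t x ∧ t x ≤ 2 * ∑ e ∈ F, w e) ∧
      ∀ x ∈ C, ∀ y ∈ C, ReachWithin T w x y |t x - t y|
  have h0 : Good {s} := by
    refine ⟨by simp, fun _ => 0, ∅, by simp, by simp, rfl, by simp, ?_⟩
    intro x hx y hy
    obtain rfl := mem_singleton.1 hx
    obtain rfl := mem_singleton.1 hy
    exact .refl _ _ _ (abs_nonneg _)
  obtain ⟨C, hC, hmax⟩ := (Set.toFinite {C | Good C}).exists_maximal ⟨_, h0⟩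
  obtain ⟨hs, t, F, hF, hFC, hts, htb, htd⟩ := hC
  have hwF : ∀ F' ⊆ T.edgeSet.toFinite.toFinset, ∑ e ∈ F', w e ≤ wWeight T w := fun F' hF' =>
    sum_le_sum_of_subset_of_nonneg hF' fun e he _ => (hw e (by simpa using he)).le
  by_cases hCu : ∀ x, x ∈ C
  · refine ⟨t, hts, fun x => (htb x (hCu x)).1, fun x => (htb x (hCu x)).2.trans ?_,
      fun x y => htd x (hCu x) y (hCu y)⟩
    linarith [hwF F hF]
  exfalso
  push Not at hCu
  obtain ⟨v, hv⟩ := hCu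
  obtain ⟨p⟩ := hT.preconnected s v
  obtain ⟨d, -, hx, hy⟩ := p.exists_boundary_dart (C : Set V) hs hv
  have hadj := d.adj
  set x := d.fst
  set y := d.snd
  simp only [mem_coe] at hx hy
  have hω : 0 < w s(x, y) := hw _ hadj
  set ω := w s(x, y)
  have hFx : s(x, y) ∉ F := fun h => hy (hFC _ h y (by simp))
  have hne : ∀ z ∈ C, z ≠ y := fun z hz h => hy (h ▸ hz)
  have key : Good (insert y C) := by
    refine ⟨mem_insert_of_mem hs,
      fun z => if z = y then t x + ω else if t z ≤ t x then t z else t z + 2 * ω,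
      insert s(x, y) F, ?_, ?_, ?_, ?_, ?_⟩
    · intro e he
      rcases mem_insert.1 he with rfl | he
      · simpa using hadj
      · exact hF he
    · intro e he z hz
      rcases mem_insert.1 he with rfl | he
      · rcases Sym2.mem_iff.1 hz with rfl | rfl
        · exact mem_insert_of_mem hx
        · exact mem_insert_self _ _
      · exact mem_insert_of_mem (hFC e he z hz)
    · have := (htb x hx).1
      simp [hne s hs, hts, this]
    · intro z hz
      rw [sum_insert hFx]
      have hx2 := htb x hx
      rcases mem_insert.1 hz with rfl | hz
      · simp only [if_true]
        constructor <;> linarith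
      · have hz2 := htb z hz
        simp only [hne z hz, if_false]
        split_ifs <;> constructor <;> linarith
    · have hyz : ∀ z ∈ C, ReachWithin T w y z
          |t x + ω - (if t z ≤ t x then t z else t z + 2 * ω)| := by
        intro z hz
        have h1 : ReachWithin T w y x ω := (ReachWithin.of_adj hadj).symm
        refine (h1.trans (htd x hx z hz)).mono ?_
        split_ifs with h
        · rw [abs_of_nonneg (by linarith)]
          exact le_trans (by linarith) (le_abs_self _)
        · rw [abs_of_neg (by linarith)]
          exact le_trans (by linarith) (neg_le_abs _)
      intro z hz z' hz'
      rcases mem_insert.1 hz with rfl | hz <;> rcases mem_insert.1 hz' with rfl | hz'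
      · exact .refl _ _ _ (abs_nonneg _)
      · simp only [if_true, hne z' hz', if_false]
        exact hyz z' hz'
      · simp only [if_true, hne z hz, if_false]
        rw [abs_sub_comm]
        exact (hyz z hz).symm
      · simp only [hne z hz, hne z' hz', if_false]
        refine (htd z hz z' hz').mono ?_
        split_ifs with h h' h'
        · exact le_rfl
        · rw [abs_of_neg (by linarith), abs_of_neg (by linarith)]
          linarith
        · rw [abs_of_pos (by linarith), abs_of_pos (by linarith)]
          linarith
        · apply le_of_eq; congr 1; ring
  exact hy (hmax key (subset_insert _ _) (mem_insert_self _ _))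

/-- Shallow-light connections: from every vertex, a set `σ '' V` of targets can be reached almost
as fast as in `G`, at small additional weight. -/
theorem exists_shallow_light {G T : SimpleGraph V} (hw : ∀ e ∈ G.edgeSet, 0 < w e) {t : V → ℝ}
    {B : ℝ} (ht0 : ∀ x, 0 ≤ t x) (htB : ∀ x, t x ≤ B)
    (htd : ∀ x y, ReachWithin T w x y |t x - t y|) {f : V → ℝ} {σ : V → V}
    (hσ : ∀ x, ReachWithin G w x (σ x) (f x)) {s₀ : V} (hts : t s₀ = 0) (hfs : f s₀ = 0)
    {a : ℝ} (ha : 0 < a) :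
    ∃ K ≤ G, wWeight K w ≤ B / a ∧
      ∀ x, ∃ y, ReachWithin (T ⊔ K) w x (σ y) ((1 + a) * f x) := by
  have hf : ∀ x, 0 ≤ f x := fun x => (hσ x).nonneg hw
  have main : ∀ S : Finset V, ∃ (P : Finset V) (l : V), P ⊆ S ∧ (l = s₀ ∨ l ∈ P) ∧
      a * ∑ x ∈ P, f x + f l ≤ t l ∧
      ∀ x ∈ S, ∃ y ∈ insert s₀ P, f y + |t x - t y| ≤ (1 + a) * f x := by
    intro S
    induction S using Finset.induction_on_max_value t with
    | empty => exact ⟨∅, s₀, by simp, Or.inl rfl, by simp [hts, hfs], by simp⟩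
    | insert x S hxS hmax ih =>
      obtain ⟨P, l, hPS, hl, hle, hP⟩ := ih
      have hlx : t l ≤ t x := by
        rcases hl with rfl | hl
        · rw [hts]; exact ht0 x
        · exact hmax l (hPS hl)
      by_cases hc : f l + (t x - t l) ≤ (1 + a) * f x
      · refine ⟨P, l, hPS.trans (subset_insert _ _), hl, hle, ?_⟩
        intro z hz
        rcases mem_insert.1 hz with rfl | hz
        · refine ⟨l, mem_insert.2 hl, ?_⟩
          rwa [abs_of_nonneg (by linarith)]
        · exact hP z hz
      · refine ⟨insert x P, x, insert_subset_insert _ hPS, Or.inr (mem_insert_self _ _), ?_, ?_⟩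
        · rw [sum_insert fun h => hxS (hPS h)]
          push Not at hc
          linarith
        · intro z hz
          rcases mem_insert.1 hz with rfl | hz
          · refine ⟨z, by simp, ?_⟩
            have := mul_nonneg ha.le (hf z)
            simp
            linarith
          · obtain ⟨y, hy, h⟩ := hP z hz
            refine ⟨y, ?_, h⟩
            rcases mem_insert.1 hy with rfl | hy <;> simp [*]
  obtain ⟨P, l, -, -, hle, hP⟩ := main univ
  obtain ⟨K, hK, hKw, hKP⟩ := exists_subgraph_of_reachWithin hw (insert s₀ P) id σ f
    fun x _ => hσ x
  refine ⟨K, hK, hKw.trans ?_, fun x => ?_⟩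
  · have h1 : ∑ x ∈ insert s₀ P, f x = ∑ x ∈ P, f x := by
      by_cases h : s₀ ∈ P
      · rw [insert_eq_of_mem h]
      · rw [sum_insert h, hfs, zero_add]
    rw [h1, le_div_iff₀ ha]
    linarith [hf l, htB l]
  · obtain ⟨y, hy, h⟩ := hP x (mem_univ x)
    refine ⟨y, ReachWithin.mono (((htd x y).of_le le_sup_left).trans
      ((hKP y hy).of_le le_sup_right)) ?_⟩
    linarith

end Tour

section Sparse

variable {I : Type*}

/-- The set of vertices reached from `v` inside `U` by at most `r` steps. -/
noncomputable def levelBall (Q : SimpleGraph I) (U : Finset I) (v : I) : ℕ → Finset I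
  | 0 => {v}
  | r + 1 => levelBall Q U v r ∪ U.filter fun z => ∃ y ∈ levelBall Q U v r, Q.Adj y z

variable {Q : SimpleGraph I} {U : Finset I} {v : I}

theorem levelBall_subset (hv : v ∈ U) (r : ℕ) : levelBall Q U v r ⊆ U := by
  induction r with
  | zero => simpa [levelBall] using hv
  | succ r ih => exact union_subset ih (filter_subset _ _)

theorem mem_levelBall (r : ℕ) : v ∈ levelBall Q U v r := by
  induction r with
  | zero => simp [levelBall]
  | succ r ih => exact mem_union_left _ ih

theorem exists_bfs_tree (r : ℕ) :
    ∃ F ≤ Q, F.edgeSet.ncard + 1 ≤ (levelBall Q U v r).card ∧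
      ∀ z ∈ levelBall Q U v r, ∃ p : F.Walk v z, p.length ≤ r := by
  induction r with
  | zero =>
    refine ⟨⊥, bot_le, by simp [levelBall], fun z hz => ?_⟩
    obtain rfl : z = v := by simpa [levelBall] using hz
    exact ⟨.nil, by simp⟩
  | succ r ih =>
    obtain ⟨F, hF, hcard, hwalk⟩ := ih
    set B := levelBall Q U v r with hB
    set P := levelBall Q U v (r + 1) \ B with hP
    have hpar : ∀ z ∈ P, ∃ y ∈ B, Q.Adj y z := by
      intro z hz
      rw [hP, mem_sdiff, levelBall, mem_union, mem_filter] at hz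
      tauto
    choose! par hparB hparQ using hpar
    set F' := SimpleGraph.fromEdgeSet ((P.image fun z => s(par z, z) : Finset (Sym2 I)) :
      Set (Sym2 I)) with hF'
    have hsub : B ⊆ levelBall Q U v (r + 1) := subset_union_left
    refine ⟨F ⊔ F', sup_le hF ?_, ?_, ?_⟩
    · intro a b hab
      rw [hF', SimpleGraph.fromEdgeSet_adj] at hab
      obtain ⟨z, hz, h⟩ := by simpa using hab.1
      have h1 := hparQ z hz
      rcases h with ⟨rfl, rfl⟩ | ⟨rfl, rfl⟩
      · exact h1
      · exact h1.symm
    · have h1 : (F ⊔ F').edgeSet.ncard ≤ F.edgeSet.ncard + F'.edgeSet.ncard := by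
        rw [SimpleGraph.edgeSet_sup]
        exact Set.ncard_union_le _ _
      have h2 : F'.edgeSet.ncard ≤ P.card := by
        refine le_trans (Set.ncard_le_ncard (t := ((P.image fun z => s(par z, z) :
          Finset (Sym2 I)) : Set (Sym2 I))) ?_ (Finset.finite_toSet _)) ?_
        · rw [hF', SimpleGraph.edgeSet_fromEdgeSet]
          exact Set.sdiff_subset
        · rw [Set.ncard_coe_finset]
          exact card_image_le
      have h3 : P.card + B.card = (levelBall Q U v (r + 1)).card :=
        card_sdiff_add_card_eq_card hsub
      omega
    · intro z hz
      by_cases hzB : z ∈ B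
      · obtain ⟨p, hp⟩ := hwalk z hzB
        exact ⟨p.mapLe le_sup_left, by simpa using hp.trans (Nat.le_succ r)⟩
      · have hzP : z ∈ P := mem_sdiff.2 ⟨hz, hzB⟩
        obtain ⟨p, hp⟩ := hwalk _ (hparB z hzP)
        have hadj : (F ⊔ F').Adj (par z) z := by
          refine Or.inr ?_
          rw [hF', SimpleGraph.fromEdgeSet_adj]
          exact ⟨by simpa using ⟨z, hzP, Or.inl ⟨rfl, rfl⟩⟩, (hparQ z hzP).ne⟩
        exact ⟨(p.mapLe le_sup_left).concat hadj, by simpa using hp⟩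

theorem exists_levelBall_card_le {g : ℝ} (hg : 1 ≤ g) {R : ℕ} (hR : 1 ≤ R) (hv : v ∈ U)
    (hU : (U.card : ℝ) ≤ g ^ R) :
    ∃ r < R, ((levelBall Q U v (r + 1)).card : ℝ) ≤ g * (levelBall Q U v r).card := by
  by_contra! h
  have key : ∀ r, r ≤ R → g ^ r ≤ ((levelBall Q U v r).card : ℝ) ∧
      (1 ≤ r → g ^ r < ((levelBall Q U v r).card : ℝ)) := by
    intro r
    induction r with
    | zero => simp [levelBall]
    | succ r ih =>
      intro hr
      have h1 := (ih (by omega)).1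
      have h2 := h r (by omega)
      have h3 : g ^ (r + 1) < ((levelBall Q U v (r + 1)).card : ℝ) := by
        refine lt_of_le_of_lt ?_ h2
        rw [pow_succ']
        exact mul_le_mul_of_nonneg_left h1 (by linarith)
      exact ⟨h3.le, fun _ => h3⟩
  have h1 := (key R le_rfl).2 hR
  have h2 : ((levelBall Q U v R).card : ℝ) ≤ U.card := by
    exact_mod_cast card_le_card (levelBall_subset hv R)
  linarith

/-- A graph on at most `g ^ R` vertices has a subgraph with at most `g` edges per vertex
and hop-stretch at most `2 R`. -/
theorem exists_sparse_subgraph (Q : SimpleGraph I) {g : ℝ} (hg : 1 ≤ g) {R : ℕ} (hR : 1 ≤ R)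
    (U : Finset I) (hU : (U.card : ℝ) ≤ g ^ R) :
    ∃ F ≤ Q, (F.edgeSet.ncard : ℝ) ≤ g * U.card ∧
      ∀ a ∈ U, ∀ b ∈ U, Q.Adj a b → ∃ p : F.Walk a b, p.length ≤ 2 * R := by
  induction U using Finset.strongInduction with
  | H U ih =>
    rcases U.eq_empty_or_nonempty with rfl | ⟨v, hv⟩
    · exact ⟨⊥, bot_le, by simp, by simp⟩
    obtain ⟨r, hr, hcard⟩ := exists_levelBall_card_le (Q := Q) hg hR hv hU
    set B := levelBall Q U v r with hB
    have hBU : B ⊆ U := levelBall_subset hv r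
    have hss : U \ B ⊂ U := sdiff_ssubset hBU ⟨v, mem_levelBall r⟩
    obtain ⟨F, hF, hFc, hFw⟩ := ih (U \ B) hss
      (le_trans (by exact_mod_cast card_le_card hss.1) hU)
    obtain ⟨F', hF', hFc', hFw'⟩ := exists_bfs_tree (Q := Q) (U := U) (v := v) (r + 1)
    refine ⟨F' ⊔ F, sup_le hF' hF, ?_, ?_⟩
    · have h1 : (F' ⊔ F).edgeSet.ncard ≤ F'.edgeSet.ncard + F.edgeSet.ncard := by
        rw [SimpleGraph.edgeSet_sup]
        exact Set.ncard_union_le _ _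
      have h2 : ((U \ B).card : ℝ) + B.card = U.card := by
        exact_mod_cast card_sdiff_add_card_eq_card hBU
      have h3 : ((F' ⊔ F).edgeSet.ncard : ℝ) ≤ F'.edgeSet.ncard + F.edgeSet.ncard := by
        exact_mod_cast h1
      have h4 : (F'.edgeSet.ncard : ℝ) + 1 ≤ (levelBall Q U v (r + 1)).card := by
        exact_mod_cast hFc'
      rw [← h2, mul_add]
      linarith
    · have key : ∀ a ∈ B, ∀ b ∈ U, Q.Adj a b → ∃ p : (F' ⊔ F).Walk a b, p.length ≤ 2 * R := by
        intro a ha b hb hab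
        have hb' : b ∈ levelBall Q U v (r + 1) :=
          mem_union_right _ (mem_filter.2 ⟨hb, a, ha, hab⟩)
        obtain ⟨p, hp⟩ := hFw' a (mem_union_left _ ha)
        obtain ⟨p', hp'⟩ := hFw' b hb'
        refine ⟨(p.reverse.append p').mapLe le_sup_left, ?_⟩
        simp only [SimpleGraph.Walk.mapLe, SimpleGraph.Walk.length_map,
          SimpleGraph.Walk.length_append, SimpleGraph.Walk.length_reverse]
        omega
      intro a ha b hb hab
      by_cases haB : a ∈ B
      · exact key a haB b hb hab
      by_cases hbB : b ∈ B
      · obtain ⟨p, hp⟩ := key b hbB a ha hab.symm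
        exact ⟨p.reverse, by simpa using hp⟩
      obtain ⟨p, hp⟩ := hFw a (mem_sdiff.2 ⟨ha, haB⟩) b (mem_sdiff.2 ⟨hb, hbB⟩) hab
      exact ⟨p.mapLe le_sup_right, by simpa [SimpleGraph.Walk.mapLe] using hp⟩

end Sparse

section Terminal

variable {V : Type*} [Fintype V] {w : Sym2 V → ℝ} {G T : SimpleGraph V}

theorem exists_sup_subgraph (hw : ∀ e ∈ G.edgeSet, 0 < w e) {ι : Type*} (P : Finset ι)
    (K : ι → SimpleGraph V) (c : ι → ℝ) (hK : ∀ i ∈ P, K i ≤ G)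
    (hc : ∀ i ∈ P, wWeight (K i) w ≤ c i) :
    ∃ K' ≤ G, wWeight K' w ≤ ∑ i ∈ P, c i ∧ ∀ i ∈ P, K i ≤ K' := by
  induction P using Finset.induction_on with
  | empty => exact ⟨⊥, bot_le, by simp [wWeight_bot], by simp⟩
  | insert i P hi ih =>
    obtain ⟨K', hK', h1, h2⟩ := ih (fun j hj => hK j (mem_insert_of_mem hj))
      (fun j hj => hc j (mem_insert_of_mem hj))
    have hKi := hK i (mem_insert_self _ _)
    refine ⟨K i ⊔ K', sup_le hKi hK', ?_, ?_⟩
    · refine (wWeight_sup_le fun e he => hw e (SimpleGraph.edgeSet_mono hKi he)).trans ?_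
      rw [sum_insert hi]
      linarith [hc i (mem_insert_self _ _)]
    · intro j hj
      rcases mem_insert.1 hj with rfl | hj
      · exact le_sup_left
      · exact (h2 j hj).trans le_sup_right

/-- Terminals at distance at most `W` can be connected cheaply with the help of `T`, by clustering
the tour coordinate into pieces of length `L`. -/
theorem exists_terminal_scale (hw : ∀ e ∈ G.edgeSet, 0 < w e) (hG : G.Connected) {t : V → ℝ}
    (ht0 : ∀ x, 0 ≤ t x) (htd : ∀ x y, ReachWithin T w x y |t x - t y|)
    (S : Finset V) {g : ℝ} (hg : 1 ≤ g) {R : ℕ} (hR : 1 ≤ R) (hS : (S.card : ℝ) ≤ g ^ R)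
    {W L : ℝ} (hW : 0 < W) (hL : 0 < L) {m : ℕ} (hm : ∀ x, t x ≤ L * m) :
    ∃ K ≤ G, wWeight K w ≤ g * (m + 1) * W ∧ ∀ x ∈ S, ∀ y ∈ S, wdist G w x y ≤ W →
      ReachWithin (T ⊔ K) w x y (2 * R * (W + L) + L) := by
  have hfl : ∀ x, ⌊t x / L⌋₊ < m + 1 := by
    intro x
    rw [Nat.lt_succ_iff, ← Nat.floor_natCast (R := ℝ) m]
    apply Nat.floor_le_floor
    rw [div_le_iff₀ hL]
    linarith [hm x]
  let π : V → Fin (m + 1) := fun x => ⟨⌊t x / L⌋₊, hfl x⟩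
  have hπ : ∀ x y, π x = π y → ReachWithin T w x y L := by
    intro x y h
    have h' : ⌊t x / L⌋₊ = ⌊t y / L⌋₊ := by simpa [π] using h
    refine (htd x y).mono ?_
    have h1 := Nat.floor_le (div_nonneg (ht0 x) hL.le)
    have h2 := Nat.lt_floor_add_one (t x / L)
    have h3 := Nat.floor_le (div_nonneg (ht0 y) hL.le)
    have h4 := Nat.lt_floor_add_one (t y / L)
    rw [h'] at h1 h2
    have h5 : |t x / L - t y / L| ≤ 1 := abs_le.2 ⟨by linarith, by linarith⟩
    rw [← sub_div, abs_div, abs_of_pos hL, div_le_one hL] at h5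
    exact h5
  let Q : SimpleGraph (Fin (m + 1)) :=
    { Adj := fun i i' => i ≠ i' ∧ ∃ x ∈ S, ∃ y ∈ S, π x = i ∧ π y = i' ∧ wdist G w x y ≤ W
      symm := ⟨by
        rintro i i' ⟨h, x, hx, y, hy, h1, h2, h3⟩
        exact ⟨h.symm, y, hy, x, hx, h2, h1, by rwa [wdist_comm]⟩⟩
      loopless := ⟨fun i h => h.1 rfl⟩ }
  obtain ⟨F, hF, hFc, hFw⟩ := exists_sparse_subgraph Q hg hR (S.image π)
    (le_trans (by exact_mod_cast card_image_le) hS)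
  have hrep : ∀ e ∈ F.edgeSet.toFinite.toFinset, ∃ x y, e = s(π x, π y) ∧ wdist G w x y ≤ W := by
    intro e
    induction e with
    | h i i' =>
      intro he
      obtain ⟨-, x, -, y, -, rfl, rfl, h⟩ := hF (by simpa using he : F.Adj i i')
      exact ⟨x, y, rfl, h⟩
  have := hG.nonempty
  choose! a b hab habW using hrep
  obtain ⟨K, hK, hKw, hKe⟩ := exists_subgraph_of_reachWithin hw F.edgeSet.toFinite.toFinset a b
    (fun _ => W) fun e he => (reachWithin_wdist hw (hG.preconnected _ _)).mono (habW e he)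
  refine ⟨K, hK, ?_, ?_⟩
  · refine hKw.trans ?_
    rw [sum_const, nsmul_eq_mul]
    apply mul_le_mul_of_nonneg_right _ hW.le
    rw [← Set.ncard_eq_toFinset_card]
    refine hFc.trans (mul_le_mul_of_nonneg_left ?_ (by linarith))
    have := card_le_univ (S.image π)
    rw [Fintype.card_fin] at this
    exact_mod_cast this
  · have hwalk : ∀ (i i' : Fin (m + 1)) (p : F.Walk i i') (x y : V), π x = i → π y = i' →
        ReachWithin (T ⊔ K) w x y (p.length * (W + L) + L) := by
      intro i i' p
      induction p with
      | nil =>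
        intro x y hx hy
        simpa using (hπ x y (hx.trans hy.symm)).of_le le_sup_left
      | @cons i j l hadj p ih =>
        intro x y hx hy
        have he : s(i, j) ∈ F.edgeSet.toFinite.toFinset := by simpa using hadj
        have hab' := hab _ he
        have hr := (hKe _ he).of_le (le_sup_right : K ≤ T ⊔ K)
        rw [SimpleGraph.Walk.length_cons]
        push_cast
        rcases Sym2.eq_iff.1 hab' with ⟨h1, h2⟩ | ⟨h1, h2⟩
        · refine ((((hπ x _ (hx.trans h1)).of_le le_sup_left).trans hr).trans
            (ih _ y h2.symm hy)).mono ?_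
          linarith
        · refine ((((hπ x _ (hx.trans h1)).of_le le_sup_left).trans hr.symm).trans
            (ih _ y h2.symm hy)).mono ?_
          linarith
    intro x hx y hy hd
    by_cases hxy : π x = π y
    · refine ((hπ x y hxy).of_le le_sup_left).mono ?_
      have : (0 : ℝ) ≤ 2 * R * (W + L) := by positivity
      linarith
    · obtain ⟨p, hp⟩ := hFw _ (mem_image_of_mem π hx) _ (mem_image_of_mem π hy)
        ⟨hxy, x, hx, y, hy, rfl, rfl, hd⟩
      refine (hwalk _ _ p x y rfl rfl).mono ?_
      have : (p.length : ℝ) ≤ 2 * R := by exact_mod_cast hp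
      have := mul_le_mul_of_nonneg_right this (by linarith : (0 : ℝ) ≤ W + L)
      linarith

/-- A light subgraph which, together with `T`, has bounded stretch on a set of terminals. -/
theorem exists_terminal_spanner (hw : ∀ e ∈ G.edgeSet, 0 < w e) (hG : G.Connected) {t : V → ℝ}
    {B : ℝ} (hB : 0 < B) (ht0 : ∀ x, 0 ≤ t x) (htB : ∀ x, t x ≤ B)
    (htd : ∀ x y, ReachWithin T w x y |t x - t y|)
    (S : Finset V) {k : ℕ} (hSk : S.card ≤ 2 ^ k) {g : ℝ} (hg : 1 ≤ g) {R : ℕ} (hR : 1 ≤ R)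
    (hS : (2 : ℝ) ^ k ≤ g ^ R) {l : ℝ} (hl : 1 ≤ l) :
    ∃ K ≤ G, wWeight K w ≤ B / l * (1 + 4 * k * g) ∧ ∀ x ∈ S, ∀ y ∈ S,
      ReachWithin (T ⊔ K) w x y ((8 * R + 2) * l * wdist G w x y) := by
  have hl0 : 0 < l := by linarith
  set W := B / l with hWdef
  have hW : 0 < W := div_pos hB hl0
  have hBW : B = l * W := by rw [hWdef]; field_simp
  have hdist : ∀ x y, ReachWithin G w x y (wdist G w x y) := fun x y =>
    reachWithin_wdist hw (hG.preconnected x y)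
  have hd0 : ∀ x y, 0 ≤ wdist G w x y := fun x y => wdist_nonneg hw x y
  have hSg : (S.card : ℝ) ≤ g ^ R := le_trans (by exact_mod_cast hSk) hS
  have hscale : ∀ j : ℕ, ∃ K ≤ G, wWeight K w ≤ 2 * g * W ∧ ∀ x ∈ S, ∀ y ∈ S,
      wdist G w x y ≤ W * (1 / 2) ^ j →
      ReachWithin (T ⊔ K) w x y ((4 * R + 1) * l * (W * (1 / 2) ^ j)) := by
    intro j
    have hWj : 0 < W * (1 / 2) ^ j := by positivity
    have h2 : ((1 : ℝ) / 2) ^ j * 2 ^ j = 1 := by rw [← mul_pow]; norm_num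
    obtain ⟨K, hK, hKw, hKr⟩ := exists_terminal_scale (m := 2 ^ j) hw hG ht0 htd S hg hR hSg hWj
      (mul_pos hl0 hWj) (by
        intro x
        push_cast
        have : l * (W * (1 / 2) ^ j) * 2 ^ j = B := by
          rw [hBW]; linear_combination l * W * h2
        rw [this]; exact htB x)
    refine ⟨K, hK, hKw.trans ?_, fun x hx y hy h => (hKr x hx y hy h).mono ?_⟩
    · push_cast
      have h3 : ((1 : ℝ) / 2) ^ j ≤ 1 := pow_le_one₀ (by norm_num) (by norm_num)
      have h4 : g * (2 ^ j + 1) * (W * (1 / 2) ^ j) = g * W * (1 + (1 / 2) ^ j) := by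
        linear_combination g * W * h2
      rw [h4]
      have : 0 ≤ g * W := by positivity
      nlinarith
    · set X := W * (1 / 2) ^ j
      have h5 : X ≤ l * X := by nlinarith
      have h6 : (R : ℝ) * X ≤ R * (l * X) := mul_le_mul_of_nonneg_left h5 (by positivity)
      nlinarith
  choose K hK hKw hKr using hscale
  obtain ⟨K₁, hK₁, hK₁w, hK₁r⟩ := exists_sup_subgraph hw (range (2 * k)) K (fun _ => 2 * g * W)
    (fun i _ => hK i) (fun i _ => hKw i)
  set P := (S ×ˢ S).filter fun p => wdist G w p.1 p.2 ≤ W * (1 / 2) ^ (2 * k) with hP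
  obtain ⟨K₂, hK₂, hK₂w, hK₂r⟩ := exists_subgraph_of_reachWithin hw P Prod.fst Prod.snd
    (fun p => wdist G w p.1 p.2) fun p _ => hdist _ _
  refine ⟨K₁ ⊔ K₂, sup_le hK₁ hK₂, ?_, ?_⟩
  · refine (wWeight_sup_le fun e he => hw e (SimpleGraph.edgeSet_mono hK₁ he)).trans ?_
    have h1 : ∑ p ∈ P, wdist G w p.1 p.2 ≤ W := by
      calc _ ≤ ∑ p ∈ P, W * (1 / 2) ^ (2 * k) := sum_le_sum fun p hp => (mem_filter.1 hp).2
        _ = P.card * (W * (1 / 2) ^ (2 * k)) := by rw [sum_const, nsmul_eq_mul]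
        _ ≤ 2 ^ (2 * k) * (W * (1 / 2) ^ (2 * k)) := by
          apply mul_le_mul_of_nonneg_right _ (by positivity)
          have : P.card ≤ 2 ^ k * 2 ^ k := (card_filter_le _ _).trans
            (by rw [card_product]; exact Nat.mul_le_mul hSk hSk)
          rw [two_mul, pow_add]
          exact_mod_cast this
        _ = W := by
          have : ((1 : ℝ) / 2) ^ (2 * k) * 2 ^ (2 * k) = 1 := by rw [← mul_pow]; norm_num
          linear_combination W * this
    rw [sum_const, nsmul_eq_mul, card_range] at hK₁w
    push_cast at hK₁w
    linarith
  · intro x hx y hy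
    set d := wdist G w x y with hd
    have hd0' : 0 ≤ d := hd0 x y
    have hR' : (1 : ℝ) ≤ R := by exact_mod_cast hR
    have hld : d ≤ l * d := by nlinarith
    have hmain : l * d ≤ (8 * R + 2) * l * d := by nlinarith
    by_cases hdW : W < d
    · refine ((htd x y).of_le le_sup_left).mono ?_
      have h1 : |t x - t y| ≤ B :=
        abs_le.2 ⟨by linarith [ht0 x, htB y], by linarith [ht0 y, htB x]⟩
      have : l * W ≤ l * d := mul_le_mul_of_nonneg_left hdW.le hl0.le
      linarith
    push Not at hdW
    by_cases hsmall : d ≤ W * (1 / 2) ^ (2 * k)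
    · have := hK₂r (x, y) (mem_filter.2 ⟨mk_mem_product hx hy, hsmall⟩)
      refine (this.of_le (le_sup_right.trans le_sup_right)).mono ?_
      change d ≤ _
      linarith
    push Not at hsmall
    have hdpos : 0 < d / W := div_pos (lt_trans (by positivity) hsmall) hW
    obtain ⟨j, hj1, hj2⟩ := exists_nat_pow_near_of_lt_one hdpos ((div_le_one hW).2 hdW)
      (by norm_num : (0 : ℝ) < 1 / 2) (by norm_num)
    rw [lt_div_iff₀ hW] at hj1
    rw [div_le_iff₀ hW] at hj2
    have hj : j < 2 * k := by
      by_contra h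
      push Not at h
      have : ((1 : ℝ) / 2) ^ j ≤ (1 / 2) ^ (2 * k) :=
        pow_le_pow_of_le_one (by norm_num) (by norm_num) h
      have := mul_le_mul_of_nonneg_right this hW.le
      linarith
    refine ((hKr j x hx y hy (by linarith)).of_le
      (sup_le_sup_left ((hK₁r j (mem_range.2 hj)).trans le_sup_left) T)).mono ?_
    have h3 : W * (1 / 2) ^ j ≤ 2 * d := by
      rw [pow_succ] at hj1; linarith
    calc (4 * R + 1) * l * (W * (1 / 2) ^ j) ≤ (4 * R + 1) * l * (2 * d) := by gcongr
      _ = _ := by ring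

end Terminal

section Nets

variable {V : Type*} [Fintype V]

/-- A set of at most `2 ^ k` points meeting, up to a factor two in the radius, every ball which
contains at least a `2 ^ (-k)` fraction of the points. -/
theorem exists_net (d : V → V → ℝ) (hsymm : ∀ u v, d u v = d v u)
    (htri : ∀ u v x, d u x ≤ d u v + d v x) (k : ℕ) :
    ∃ S : Finset V, S.card ≤ 2 ^ k ∧ ∀ u r,
      Fintype.card V ≤ (univ.filter fun x => d u x ≤ r).card * 2 ^ k → ∃ s ∈ S, d u s ≤ 2 * r := by
  have hrad : ∀ u, ∃ ρ : ℝ, Fintype.card V ≤ (univ.filter fun x => d u x ≤ ρ).card * 2 ^ k ∧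
      ∀ r, Fintype.card V ≤ (univ.filter fun x => d u x ≤ r).card * 2 ^ k → ρ ≤ r := by
    intro u
    have hlarge : ∀ (r : ℝ), Fintype.card V ≤ (univ.filter fun x => d u x ≤ r).card * 2 ^ k →
        ∃ y, d u y ≤ r ∧ Fintype.card V ≤ (univ.filter fun x => d u x ≤ d u y).card * 2 ^ k := by
      intro r hr
      have hne : (univ.filter fun x => d u x ≤ r).Nonempty := by
        rw [nonempty_iff_ne_empty]
        intro h
        rw [h] at hr
        have : 0 < Fintype.card V := Fintype.card_pos_iff.2 ⟨u⟩
        simp at hr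
        omega
      obtain ⟨y, hy, hmax⟩ := exists_max_image _ (d u) hne
      refine ⟨y, (mem_filter.1 hy).2, hr.trans (Nat.mul_le_mul_right _ (card_le_card ?_))⟩
      intro x hx
      exact mem_filter.2 ⟨mem_univ _, hmax x hx⟩
    obtain ⟨m, -, hm⟩ := exists_max_image univ (d u) ⟨u, mem_univ u⟩
    have hall : Fintype.card V ≤ (univ.filter fun x => d u x ≤ d u m).card * 2 ^ k := by
      rw [filter_true_of_mem fun x _ => hm x (mem_univ x), card_univ]
      exact Nat.le_mul_of_pos_right _ (by positivity)
    obtain ⟨y, hy, hmin⟩ := exists_min_image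
      (univ.filter fun y => Fintype.card V ≤ (univ.filter fun x => d u x ≤ d u y).card * 2 ^ k)
      (d u) ⟨m, mem_filter.2 ⟨mem_univ _, hall⟩⟩
    refine ⟨d u y, (mem_filter.1 hy).2, fun r hr => ?_⟩
    obtain ⟨z, hz, hz'⟩ := hlarge r hr
    exact (hmin z (mem_filter.2 ⟨mem_univ _, hz'⟩)).trans hz
  choose ρ hρ hρmin using hrad
  let b : V → Finset V := fun u => univ.filter fun x => d u x ≤ ρ u
  have main : ∀ S : Finset V, ∃ P ⊆ S, (P : Set V).PairwiseDisjoint b ∧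
      ∀ u ∈ S, ∃ s ∈ P, d u s ≤ 2 * ρ u := by
    intro S
    induction S using Finset.induction_on_max_value ρ with
    | empty => exact ⟨∅, by simp⟩
    | insert a S haS hmax ih =>
      obtain ⟨P, hPS, hdisj, hP⟩ := ih
      by_cases hc : ∃ s ∈ P, ¬ Disjoint (b a) (b s)
      · refine ⟨P, hPS.trans (subset_insert _ _), hdisj, fun u hu => ?_⟩
        rcases mem_insert.1 hu with rfl | hu
        · obtain ⟨s, hs, hd⟩ := hc
          obtain ⟨x, hx, hx'⟩ := not_disjoint_iff.1 hd
          refine ⟨s, hs, ?_⟩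
          have h1 : d u x ≤ ρ u := (mem_filter.1 hx).2
          have h2 : d s x ≤ ρ s := (mem_filter.1 hx').2
          have h3 := hmax s (hPS hs)
          have h4 := htri u x s
          rw [hsymm x s] at h4
          linarith
        · exact hP u hu
      · push Not at hc
        refine ⟨insert a P, insert_subset_insert _ hPS, ?_, fun u hu => ?_⟩
        · rw [coe_insert]
          exact hdisj.insert fun s hs _ => hc s hs
        · rcases mem_insert.1 hu with rfl | hu
          · obtain ⟨x, hx⟩ : (b u).Nonempty := by
              rw [nonempty_iff_ne_empty]
              intro h
              have h1 := hρ u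
              change _ ≤ (b u).card * _ at h1
              rw [h] at h1
              have : 0 < Fintype.card V := Fintype.card_pos_iff.2 ⟨u⟩
              simp at h1
              omega
            refine ⟨u, mem_insert_self _ _, ?_⟩
            have h1 : d u x ≤ ρ u := (mem_filter.1 hx).2
            have h2 := htri u x u
            rw [hsymm x u] at h2
            linarith
          · obtain ⟨s, hs, h⟩ := hP u hu
            exact ⟨s, mem_insert_of_mem hs, h⟩
  obtain ⟨P, -, hdisj, hP⟩ := main univ
  refine ⟨P, ?_, fun u r hr => ?_⟩
  · rcases P.eq_empty_or_nonempty with rfl | ⟨u, -⟩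
    · simp
    have hN : 0 < Fintype.card V := Fintype.card_pos_iff.2 ⟨u⟩
    have h1 : ∑ s ∈ P, (b s).card ≤ Fintype.card V := by
      rw [← card_biUnion hdisj]
      exact card_le_univ _
    have h2 : P.card * Fintype.card V ≤ (∑ s ∈ P, (b s).card) * 2 ^ k := by
      rw [sum_mul, ← smul_eq_mul]
      exact card_nsmul_le_sum _ _ _ fun s _ => hρ s
    have h3 := h2.trans (Nat.mul_le_mul_right (2 ^ k) h1)
    rw [mul_comm (Fintype.card V)] at h3
    exact Nat.le_of_mul_le_mul_right h3 hN
  · obtain ⟨s, hs, h⟩ := hP u (mem_univ u)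
    exact ⟨s, hs, h.trans (by linarith [hρmin u r hr])⟩

end Nets

section Rank

variable {V : Type*}

theorem rpow_neg_le_sub_rpow {β : ℝ} (h0 : 0 < β) (h1 : β < 1) (m : ℕ) :
    ((m : ℝ) + 1) ^ (-β) ≤ (((m : ℝ) + 1) ^ (1 - β) - (m : ℝ) ^ (1 - β)) / (1 - β) := by
  have hm : (0 : ℝ) < (m : ℝ) + 1 := by positivity
  rw [le_div_iff₀ (by linarith)]
  have h2 : (1 + -1 / ((m : ℝ) + 1)) ^ (1 - β) ≤ 1 + (1 - β) * (-1 / ((m : ℝ) + 1)) := by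
    apply rpow_one_add_le_one_add_mul_self _ (by linarith) (by linarith)
    rw [le_div_iff₀ hm]
    have : (0 : ℝ) ≤ m := by positivity
    linarith
  have h3 : (m : ℝ) ^ (1 - β) = ((m : ℝ) + 1) ^ (1 - β) * (1 + -1 / ((m : ℝ) + 1)) ^ (1 - β) := by
    rw [← Real.mul_rpow hm.le]
    · congr 1; field_simp; ring
    · have : 1 + -1 / ((m : ℝ) + 1) = m / (m + 1) := by field_simp; ring
      rw [this]; positivity
  have h4 : ((m : ℝ) + 1) ^ (1 - β) = ((m : ℝ) + 1) * ((m : ℝ) + 1) ^ (-β) := by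
    rw [sub_eq_add_neg, Real.rpow_add hm, Real.rpow_one]
  have h5 := mul_le_mul_of_nonneg_left h2 (Real.rpow_nonneg hm.le (1 - β))
  rw [← h3] at h5
  have h6 : ((m : ℝ) + 1) ^ (1 - β) * (1 + (1 - β) * (-1 / ((m : ℝ) + 1))) =
      ((m : ℝ) + 1) ^ (1 - β) - (1 - β) * ((m : ℝ) + 1) ^ (-β) := by
    rw [h4]; field_simp; ring
  linarith

theorem sum_rank_rpow_neg_le {β : ℝ} (h0 : 0 < β) (h1 : β < 1) (f : V → ℝ) (S : Finset V) :
    ∑ v ∈ S, ((S.filter fun x => f x ≤ f v).card : ℝ) ^ (-β) ≤ (S.card : ℝ) ^ (1 - β) / (1 - β) := by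
  induction S using Finset.induction_on_max_value f with
  | empty => simp [Real.zero_rpow (by linarith : 1 - β ≠ 0)]
  | insert a S haS hmax ih =>
    rw [sum_insert haS, card_insert_of_notMem haS]
    have h2 : (insert a S).filter (fun x => f x ≤ f a) = insert a S := by
      apply filter_true_of_mem
      intro x hx
      rcases mem_insert.1 hx with rfl | hx
      · exact le_rfl
      · exact hmax x hx
    have h3 : ∑ v ∈ S, (((insert a S).filter fun x => f x ≤ f v).card : ℝ) ^ (-β) ≤
        ∑ v ∈ S, ((S.filter fun x => f x ≤ f v).card : ℝ) ^ (-β) := by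
      apply sum_le_sum
      intro v hv
      apply Real.rpow_le_rpow_of_nonpos
      · have : 0 < (S.filter fun x => f x ≤ f v).card := card_pos.2 ⟨v, mem_filter.2 ⟨hv, le_rfl⟩⟩
        exact_mod_cast this
      · have := card_le_card (filter_subset_filter (fun x => f x ≤ f v) (subset_insert a S))
        exact_mod_cast this
      · linarith
    have h4 := rpow_neg_le_sub_rpow h0 h1 S.card
    rw [h2, card_insert_of_notMem haS]
    push_cast
    rw [sub_div] at h4
    linarith

/-- The number of points at distance from `u` at most that of `v`. -/
noncomputable def ballCard [Fintype V] (d : V → V → ℝ) (u v : V) : ℕ :=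
  (univ.filter fun x => d u x ≤ d u v).card

theorem ballCard_pos [Fintype V] (d : V → V → ℝ) (u v : V) : 0 < ballCard d u v :=
  card_pos.2 ⟨v, by simp⟩

theorem ballCard_le [Fintype V] (d : V → V → ℝ) (u v : V) : ballCard d u v ≤ Fintype.card V :=
  card_le_univ _

theorem sum_ballCard_rpow_le [Fintype V] {β : ℝ} (h0 : 0 < β) (h1 : β < 1) (d : V → V → ℝ) :
    ∑ u, ∑ v, ((Fintype.card V : ℝ) / ballCard d u v) ^ β ≤
      (Fintype.card V : ℝ) ^ 2 / (1 - β) := by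
  have key : ∀ u, ∑ v, ((Fintype.card V : ℝ) / ballCard d u v) ^ β ≤
      (Fintype.card V : ℝ) / (1 - β) := by
    intro u
    have hN : (0 : ℝ) < Fintype.card V := by exact_mod_cast Fintype.card_pos_iff.2 ⟨u⟩
    have := mul_le_mul_of_nonneg_left (sum_rank_rpow_neg_le h0 h1 (d u) univ)
      (Real.rpow_nonneg hN.le β)
    rw [card_univ, mul_div_assoc', ← Real.rpow_add hN, add_sub_cancel, Real.rpow_one,
      mul_sum] at this
    refine le_trans (le_of_eq (sum_congr rfl fun v _ => ?_)) this
    rw [Real.div_rpow hN.le (by positivity), Real.rpow_neg (by positivity), div_eq_mul_inv]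
    rfl
  refine (sum_le_sum fun u _ => key u).trans (le_of_eq ?_)
  rw [sum_const, card_univ, nsmul_eq_mul]
  ring

end Rank

section LightSpanner

theorem exists_level_spanner {V : Type*} [Fintype V] {w : Sym2 V → ℝ} {G T : SimpleGraph V}
    (hw : ∀ e ∈ G.edgeSet, 0 < w e) (hG : G.Connected) (hTG : T ≤ G) (hT : T.Connected)
    (hM : 0 < wWeight T w) {b : ℝ} (hb : 1 ≤ b) {R : ℕ} (hR : 1 ≤ R) (hbR : 2 ≤ b ^ R)
    {L : ℝ} (hL : 1 ≤ L) (k : ℕ) :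
    ∃ K ≤ G, wWeight K w ≤ 2 * wWeight T w / L * ((2 + 4 * k) * (1 / b) ^ k) ∧
      ∀ u v, Fintype.card V ≤ ballCard (wdist G w) u v * 2 ^ k →
        ReachWithin (T ⊔ K) w u v
          (2 * L ^ 2 * (6 + 7 * (8 * R + 2)) * b ^ (3 * k) * wdist G w u v) := by
  have hwT : ∀ e ∈ T.edgeSet, 0 < w e := fun e he => hw e (SimpleGraph.edgeSet_mono hTG he)
  have hreach : ∀ x y, ReachWithin G w x y (wdist G w x y) := fun x y =>
    reachWithin_wdist hw (hG.preconnected x y)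
  have htri : ∀ u v x, wdist G w u x ≤ wdist G w u v + wdist G w v x := fun u v x =>
    wdist_triangle_of_reachable hw (hG.preconnected u v) (hG.preconnected v x)
  have hd0 : ∀ x y, 0 ≤ wdist G w x y := wdist_nonneg hw
  obtain ⟨S, hSc, hS⟩ := exists_net (wdist G w) (wdist_comm G w) htri k
  have hb0 : 0 < b := by linarith
  have hL0 : 0 < L := by linarith
  set M := wWeight T w with hMdef
  rcases S.eq_empty_or_nonempty with rfl | hSne
  · refine ⟨⊥, bot_le, by rw [wWeight_bot]; positivity, fun u v h => ?_⟩
    obtain ⟨s, hs, -⟩ := hS u _ h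
    simp at hs
  obtain ⟨s₀, hs₀⟩ := hSne
  obtain ⟨t, hts, ht0, htB, htd⟩ := exists_tour hT hwT s₀
  have hnear : ∀ x, ∃ s ∈ S, ∀ s' ∈ S, wdist G w x s ≤ wdist G w x s' := fun x =>
    exists_min_image S (wdist G w x) ⟨s₀, hs₀⟩
  choose σ hσS hσmin using hnear
  set f : V → ℝ := fun x => wdist G w x (σ x) with hf
  have hfs : f s₀ = 0 := le_antisymm ((hσmin s₀ s₀ hs₀).trans_eq (wdist_self hw s₀)) (hd0 _ _)
  have hbk : 1 ≤ b ^ k := one_le_pow₀ hb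
  have hbk2 : 1 ≤ b ^ (2 * k) := one_le_pow₀ hb
  set a := L * b ^ k with ha
  set l := L * b ^ (2 * k) with hl
  have ha1 : 1 ≤ a := one_le_mul_of_one_le_of_one_le hL hbk
  have hl1 : 1 ≤ l := one_le_mul_of_one_le_of_one_le hL hbk2
  obtain ⟨K₁, hK₁, hK₁w, hK₁r⟩ := exists_shallow_light hw ht0 htB htd (f := f) (σ := σ)
    (fun x => hreach _ _) hts hfs (by linarith : 0 < a)
  have hgR : (2 : ℝ) ^ k ≤ (b ^ k) ^ R := by
    rw [← pow_mul, mul_comm, pow_mul]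
    exact pow_le_pow_left₀ (by norm_num) hbR k
  obtain ⟨K₂, hK₂, hK₂w, hK₂r⟩ := exists_terminal_spanner hw hG (B := 2 * M) (by linarith) ht0 htB
    htd S hSc hbk hR hgR hl1
  refine ⟨K₁ ⊔ K₂, sup_le hK₁ hK₂, ?_, ?_⟩
  · refine (wWeight_sup_le fun e he => hw e (SimpleGraph.edgeSet_mono hK₁ he)).trans
      ((add_le_add hK₁w hK₂w).trans ?_)
    have e1 : 2 * M / a = 2 * M / L * (1 / b) ^ k := by
      rw [ha, one_div, inv_pow]; field_simp
    have e2 : 2 * M / l * (1 + 4 * k * b ^ k) =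
        2 * M / L * ((1 / b) ^ k * ((1 / b) ^ k + 4 * k)) := by
      rw [hl, one_div, inv_pow, two_mul k, pow_add]; field_simp
    rw [e1, e2, ← mul_add]
    apply mul_le_mul_of_nonneg_left _ (by positivity)
    have h1 : (1 / b) ^ k ≤ 1 := pow_le_one₀ (by positivity) (by rw [div_le_one hb0]; exact hb)
    have h2 : 0 ≤ (1 / b) ^ k := by positivity
    nlinarith
  · intro u v huv
    set δ := wdist G w u v with hδ
    have hδ0 : 0 ≤ δ := hd0 _ _
    have hfu : f u ≤ 2 * δ := by
      obtain ⟨s, hs, h⟩ := hS u δ huv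
      exact (hσmin u s hs).trans h
    have hfv : f v ≤ 4 * δ := by
      obtain ⟨s, hs, h⟩ := hS v (2 * δ) (huv.trans (Nat.mul_le_mul_right _ (card_le_card (by
        intro x hx
        refine mem_filter.2 ⟨mem_univ _, ?_⟩
        have h1 : wdist G w u x ≤ δ := (mem_filter.1 hx).2
        have h2 := htri v u x
        rw [wdist_comm G w v u] at h2
        linarith))))
      exact (hσmin v s hs).trans (by linarith)
    have hsub : T ⊔ K₁ ≤ T ⊔ (K₁ ⊔ K₂) := sup_le_sup_left le_sup_left T
    have hsub' : T ⊔ K₂ ≤ T ⊔ (K₁ ⊔ K₂) := sup_le_sup_left le_sup_right T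
    obtain ⟨x, hx⟩ := hK₁r u
    obtain ⟨y, hy⟩ := hK₁r v
    have hux : wdist G w u (σ x) ≤ (1 + a) * f u :=
      wdist_le_of_reachWithin hw (hx.of_le (sup_le hTG hK₁))
    have hvy : wdist G w v (σ y) ≤ (1 + a) * f v :=
      wdist_le_of_reachWithin hw (hy.of_le (sup_le hTG hK₁))
    have hfu' : (1 + a) * f u ≤ (1 + a) * (2 * δ) := by gcongr
    have hfv' : (1 + a) * f v ≤ (1 + a) * (4 * δ) := by gcongr
    have hxy : wdist G w (σ x) (σ y) ≤ 7 * (1 + a) * δ := by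
      have h1 := htri (σ x) u (σ y)
      have h2 := htri u v (σ y)
      rw [wdist_comm G w (σ x) u] at h1
      have : 0 ≤ a * δ := by positivity
      linarith
    refine (((hx.of_le hsub).trans ((hK₂r _ (hσS x) _ (hσS y)).of_le hsub')).trans
      (hy.symm.of_le hsub)).mono ?_
    have h3 : (8 * R + 2) * l * wdist G w (σ x) (σ y) ≤ (8 * R + 2) * l * (7 * (1 + a) * δ) := by
      gcongr
    have h4 : (1 + a) * (6 + 7 * (8 * R + 2) * l) ≤ 2 * a * (6 * l + 7 * (8 * R + 2) * l) := by
      gcongr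
      · linarith
      · linarith
    have h5 := mul_le_mul_of_nonneg_right h4 hδ0
    have h6 : 2 * a * (6 * l + 7 * (8 * R + 2) * l) * δ =
        2 * L ^ 2 * (6 + 7 * (8 * R + 2)) * b ^ (3 * k) * δ := by
      rw [ha, hl, show 3 * k = k + 2 * k by ring, pow_add]; ring
    linarith

theorem exists_light_spanner (p : ℝ) (hp : 0 < p) :
    ∃ C : ℝ, 0 < C ∧ ∀ (V : Type) [Fintype V] (G T : SimpleGraph V) (w : Sym2 V → ℝ),
      (∀ e ∈ G.edgeSet, 0 < w e) → G.Connected → T ≤ G → T.Connected →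
      ∃ K ≤ G, wWeight K w ≤ wWeight T w ∧
        ∑ e ∈ (univ : Finset V).offDiag, (wdist (T ⊔ K) w e.1 e.2 / wdist G w e.1 e.2) ^ p ≤
          C * (Fintype.card V : ℝ) ^ 2 := by
  obtain ⟨τ, hτ⟩ : ∃ τ : ℝ, τ = 1 / (6 * p) := ⟨_, rfl⟩
  have hτ0 : 0 < τ := by rw [hτ]; positivity
  obtain ⟨b, hb⟩ : ∃ b : ℝ, b = 2 ^ τ := ⟨_, rfl⟩
  have hb1 : 1 < b := by rw [hb]; exact Real.one_lt_rpow (by norm_num) hτ0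
  obtain ⟨R, hRdef⟩ : ∃ R : ℕ, R = ⌈1 / τ⌉₊ := ⟨_, rfl⟩
  have hR : 1 ≤ R := by rw [hRdef, Nat.one_le_ceil_iff]; positivity
  have hbR : 2 ≤ b ^ R := by
    rw [hb, ← Real.rpow_natCast, ← Real.rpow_mul (by norm_num)]
    have h1 : 1 / τ ≤ R := by rw [hRdef]; exact Nat.le_ceil _
    rw [div_le_iff₀ hτ0, mul_comm] at h1
    calc (2 : ℝ) = 2 ^ (1 : ℝ) := by rw [Real.rpow_one]
      _ ≤ _ := Real.rpow_le_rpow_of_exponent_le (by norm_num) h1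
  have hsum : Summable fun k : ℕ => (2 + 4 * (k : ℝ)) * (1 / b) ^ k := by
    have hn : ‖(1 / b)‖ < 1 := by
      rw [Real.norm_of_nonneg (by positivity), div_lt_one (by linarith)]; exact hb1
    have h1 := summable_pow_mul_geometric_of_norm_lt_one 1 hn
    have h0 := summable_pow_mul_geometric_of_norm_lt_one 0 hn
    refine ((h0.mul_left 2).add (h1.mul_left 4)).congr fun k => ?_
    ring
  have hterm : ∀ k : ℕ, 0 ≤ (2 + 4 * (k : ℝ)) * (1 / b) ^ k := fun k => by
    have : 0 < b := by linarith
    positivity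
  obtain ⟨c₁, hc₁⟩ : ∃ x : ℝ, x = ∑' k : ℕ, (2 + 4 * (k : ℝ)) * (1 / b) ^ k := ⟨_, rfl⟩
  have hc₁0 : 0 ≤ c₁ := by rw [hc₁]; exact tsum_nonneg hterm
  obtain ⟨L, hLdef⟩ : ∃ L : ℝ, L = 1 + 2 * c₁ := ⟨_, rfl⟩
  have hL : 1 ≤ L := by linarith
  obtain ⟨C₀, hC₀⟩ : ∃ C : ℝ, C = 2 * L ^ 2 * (6 + 7 * (8 * R + 2)) := ⟨_, rfl⟩
  have hC₀p : 0 < C₀ := by rw [hC₀]; positivity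
  refine ⟨C₀ ^ p * 2 ^ (1 / 2 : ℝ) * 2, by positivity, ?_⟩
  intro V _ G T w hw hG hTG hT
  by_cases hsub : Subsingleton V
  · refine ⟨⊥, bot_le, ?_, ?_⟩
    · rw [wWeight_bot]
      exact wWeight_nonneg fun e he => hw e (SimpleGraph.edgeSet_mono hTG he)
    · rw [sum_eq_zero]
      · positivity
      · intro e he
        exact absurd (Subsingleton.elim _ _) (mem_offDiag.1 he).2.2
  have hwT : ∀ e ∈ T.edgeSet, 0 < w e := fun e he => hw e (SimpleGraph.edgeSet_mono hTG he)
  have hM : 0 < wWeight T w := by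
    obtain ⟨u, v, huv⟩ := not_subsingleton_iff_nontrivial.1 hsub
    obtain ⟨y, hy, -, -⟩ := exists_adj_wdist_eq hwT (hT.preconnected u v) huv.symm
    refine lt_of_lt_of_le (hwT s(y, v) hy) ?_
    exact single_le_sum (f := w) (fun e he => (hwT e (by simpa using he)).le) (by simpa using hy)
  choose K hK hKw hKr using fun k => exists_level_spanner hw hG hTG hT hM hb1.le hR hbR hL k
  obtain ⟨K', hK', hK'w, hK'r⟩ := exists_sup_subgraph hw (range (Fintype.card V + 1)) K _
    (fun k _ => hK k) (fun k _ => hKw k)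
  refine ⟨K', hK', hK'w.trans ?_, ?_⟩
  · rw [← mul_sum]
    have h1 : ∑ k ∈ range (Fintype.card V + 1), (2 + 4 * (k : ℝ)) * (1 / b) ^ k ≤ c₁ := by
      rw [hc₁]; exact hsum.sum_le_tsum _ fun k _ => hterm k
    calc _ ≤ 2 * wWeight T w / L * c₁ := by gcongr
      _ = wWeight T w * (2 * c₁ / L) := by ring
      _ ≤ wWeight T w * 1 := by
        gcongr
        rw [div_le_one (by linarith)]
        linarith
      _ = _ := mul_one _
  have hN : (0 : ℝ) < Fintype.card V := by
    exact_mod_cast Fintype.card_pos_iff.2 hG.nonempty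
  have hpair : ∀ u v : V, u ≠ v → (wdist (T ⊔ K') w u v / wdist G w u v) ^ p ≤
      C₀ ^ p * 2 ^ (1 / 2 : ℝ) *
        ((Fintype.card V : ℝ) / ballCard (wdist G w) u v) ^ (1 / 2 : ℝ) := by
    intro u v huv
    have hδ : 0 < wdist G w u v := wdist_pos hw (hG.preconnected u v) huv
    have hbc : 0 < ballCard (wdist G w) u v := ballCard_pos _ _ _
    set β := ballCard (wdist G w) u v with hβ
    have hex : ∃ k, Fintype.card V ≤ β * 2 ^ k :=
      ⟨Fintype.card V, (Nat.lt_two_pow_self.le).trans (Nat.le_mul_of_pos_left _ hbc)⟩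
    set k := Nat.find hex with hk
    have hk1 : Fintype.card V ≤ β * 2 ^ k := Nat.find_spec hex
    have hk2 : k ≤ Fintype.card V :=
      Nat.find_min' hex ((Nat.lt_two_pow_self.le).trans (Nat.le_mul_of_pos_left _ hbc))
    have hβ0 : (0 : ℝ) < β := by exact_mod_cast hbc
    have hk3 : (2 : ℝ) ^ k ≤ 2 * (Fintype.card V / β) := by
      rw [mul_div_assoc', le_div_iff₀ hβ0]
      rcases Nat.eq_zero_or_pos k with h | h
      · rw [h]
        have : (β : ℝ) ≤ Fintype.card V := by exact_mod_cast ballCard_le _ _ _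
        linarith
      · have h1 := Nat.find_min hex (m := k - 1) (by omega)
        push Not at h1
        have h2 : (β : ℝ) * 2 ^ (k - 1) < Fintype.card V := by exact_mod_cast h1
        have h3 : (2 : ℝ) ^ k = 2 * 2 ^ (k - 1) := by
          rw [← pow_succ']; congr 1; omega
        rw [h3]; linarith
    have hwTK : ∀ e ∈ (T ⊔ K').edgeSet, 0 < w e := fun e he =>
      hw e (SimpleGraph.edgeSet_mono (sup_le hTG hK') he)
    have hd : wdist (T ⊔ K') w u v ≤ C₀ * b ^ (3 * k) * wdist G w u v := by
      apply wdist_le_of_reachWithin hwTK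
      rw [hC₀]
      exact (hKr k u v hk1).of_le
        (sup_le_sup_left (hK'r k (mem_range.2 (Nat.lt_succ_of_le hk2))) T)
    have hratio : wdist (T ⊔ K') w u v / wdist G w u v ≤ C₀ * b ^ (3 * k) :=
      (div_le_iff₀ hδ).2 hd
    have hbpow : (b ^ (3 * k)) ^ p = ((2 : ℝ) ^ k) ^ (1 / 2 : ℝ) := by
      rw [hb, ← Real.rpow_natCast, ← Real.rpow_natCast, ← Real.rpow_mul (by positivity),
        ← Real.rpow_mul (by positivity), ← Real.rpow_mul (by positivity)]
      congr 1
      rw [hτ]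
      push_cast
      field_simp
      ring
    calc _ ≤ (C₀ * b ^ (3 * k)) ^ p :=
          Real.rpow_le_rpow (div_nonneg (wdist_nonneg hwTK _ _) hδ.le) hratio hp.le
      _ = C₀ ^ p * ((2 : ℝ) ^ k) ^ (1 / 2 : ℝ) := by
          rw [Real.mul_rpow hC₀p.le (by positivity), hbpow]
      _ ≤ C₀ ^ p * (2 * (Fintype.card V / β)) ^ (1 / 2 : ℝ) := by gcongr
      _ = _ := by rw [Real.mul_rpow (by norm_num) (by positivity)]; ring
  calc _ ≤ ∑ e ∈ (univ : Finset V).offDiag, C₀ ^ p * 2 ^ (1 / 2 : ℝ) *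
        ((Fintype.card V : ℝ) / ballCard (wdist G w) e.1 e.2) ^ (1 / 2 : ℝ) :=
        sum_le_sum fun e he => hpair e.1 e.2 (mem_offDiag.1 he).2.2
    _ ≤ ∑ e ∈ (univ : Finset V) ×ˢ (univ : Finset V), C₀ ^ p * 2 ^ (1 / 2 : ℝ) *
        ((Fintype.card V : ℝ) / ballCard (wdist G w) e.1 e.2) ^ (1 / 2 : ℝ) := by
        apply sum_le_sum_of_subset_of_nonneg
        · intro e _; simp
        · intro e _ _; positivity
    _ = C₀ ^ p * 2 ^ (1 / 2 : ℝ) * ∑ u : V, ∑ v : V,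
        ((Fintype.card V : ℝ) / ballCard (wdist G w) u v) ^ (1 / 2 : ℝ) := by
        rw [← mul_sum, sum_product]
    _ ≤ C₀ ^ p * 2 ^ (1 / 2 : ℝ) * ((Fintype.card V : ℝ) ^ 2 / (1 - 1 / 2)) := by
        gcongr
        exact sum_ballCard_rpow_le (by norm_num) (by norm_num) _
    _ = _ := by ring

end LightSpanner

section FlatPoint

theorem integral_sub_shift_le {φ : ℝ → ℝ} (hφ : Monotone φ) {lo m : ℝ} (h0 : ∀ r, lo ≤ φ r)
    (h1 : ∀ r, φ r ≤ lo + m) {σ : ℝ} (hσ : 0 ≤ σ) (a b : ℝ) :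
    ∫ r in a..b, (φ (r + σ) - φ (r - σ)) ≤ 2 * σ * m := by
  have hi : ∀ x y, IntervalIntegrable φ MeasureTheory.volume x y := fun x y =>
    hφ.intervalIntegrable
  have hp : Monotone fun r => φ (r + σ) := fun x y h => hφ (by linarith)
  have hm : Monotone fun r => φ (r - σ) := fun x y h => hφ (by linarith)
  rw [intervalIntegral.integral_sub hp.intervalIntegrable hm.intervalIntegrable,
    intervalIntegral.integral_comp_add_right, intervalIntegral.integral_comp_sub_right]
  have e1 : (∫ r in (a + σ)..(b + σ), φ r) - ∫ r in (a - σ)..(b - σ), φ r =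
      (∫ r in (b - σ)..(b + σ), φ r) - ∫ r in (a - σ)..(a + σ), φ r := by
    have i1 := intervalIntegral.integral_add_adjacent_intervals (hi (a - σ) (a + σ))
      (hi (a + σ) (b + σ))
    have i2 := intervalIntegral.integral_add_adjacent_intervals (hi (a - σ) (b - σ))
      (hi (b - σ) (b + σ))
    linarith
  have e2 : ∫ r in (b - σ)..(b + σ), φ r ≤ ∫ _ in (b - σ)..(b + σ), (lo + m) :=
    intervalIntegral.integral_mono_on (by linarith) (hi _ _) (by simp) fun x _ => h1 x
  have e3 : ∫ _ in (a - σ)..(a + σ), lo ≤ ∫ r in (a - σ)..(a + σ), φ r :=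
    intervalIntegral.integral_mono_on (by linarith) (by simp) (hi _ _) fun x _ => h0 x
  rw [intervalIntegral.integral_const, smul_eq_mul] at e2 e3
  rw [e1]
  linarith

/-- Averaging: some point of an interval is simultaneously flat for finitely many bounded
monotone functions at prescribed scales. -/
theorem exists_flat_point {ι : Type*} (s : Finset ι) {φ : ι → ℝ → ℝ} (hφ : ∀ i, Monotone (φ i))
    {lo : ι → ℝ} {m : ℝ} (h0 : ∀ i r, lo i ≤ φ i r) (h1 : ∀ i r, φ i r ≤ lo i + m)
    {c σ : ι → ℝ} (hc : ∀ i, 0 ≤ c i) (hσ : ∀ i, 0 ≤ σ i) (a : ℝ) {W : ℝ} (hW : 0 < W) :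
    ∃ r, a ≤ r ∧ r ≤ a + W ∧
      ∀ i ∈ s, c i * (φ i (r + σ i) - φ i (r - σ i)) ≤ (∑ i ∈ s, c i * (2 * σ i * m)) / W := by
  have hii : ∀ i ∈ s, IntervalIntegrable
      (fun r => c i * (φ i (r + σ i) - φ i (r - σ i))) MeasureTheory.volume a (a + W) := by
    intro i _
    have hp : Monotone fun r => φ i (r + σ i) := fun x y h => hφ i (by linarith)
    have hm : Monotone fun r => φ i (r - σ i) := fun x y h => hφ i (by linarith)
    exact (hp.intervalIntegrable.sub hm.intervalIntegrable).const_mul _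
  have hint : ∫ r in a..(a + W), ∑ i ∈ s, c i * (φ i (r + σ i) - φ i (r - σ i)) ≤
      ∑ i ∈ s, c i * (2 * σ i * m) := by
    rw [intervalIntegral.integral_finsetSum hii]
    apply sum_le_sum
    intro i _
    rw [intervalIntegral.integral_const_mul]
    exact mul_le_mul_of_nonneg_left (integral_sub_shift_le (hφ i) (h0 i) (h1 i) (hσ i) _ _) (hc i)
  have hon : MeasureTheory.IntegrableOn
      (fun r => ∑ i ∈ s, c i * (φ i (r + σ i) - φ i (r - σ i))) (Set.Ioc a (a + W)) := by
    rw [← intervalIntegrable_iff_integrableOn_Ioc_of_le (by linarith)]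
    have := IntervalIntegrable.sum s hii
    rwa [sum_fn] at this
  obtain ⟨r, hr, hle⟩ := MeasureTheory.exists_le_setAverage
    (μ := MeasureTheory.volume) (s := Set.Ioc a (a + W)) (by simp [hW]) (by simp) hon
  refine ⟨r, hr.1.le, hr.2, fun i hi => ?_⟩
  rw [MeasureTheory.setAverage_eq, ← intervalIntegral.integral_of_le (by linarith)] at hle
  simp only [smul_eq_mul, Real.volume_real_Ioc_of_le (by linarith : a ≤ a + W),
    add_sub_cancel_left] at hle
  have h2 : c i * (φ i (r + σ i) - φ i (r - σ i)) ≤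
      ∑ i ∈ s, c i * (φ i (r + σ i) - φ i (r - σ i)) :=
    single_le_sum (f := fun i => c i * (φ i (r + σ i) - φ i (r - σ i)))
      (fun i _ => mul_nonneg (hc i) (sub_nonneg.2 (hφ i (by linarith [hσ i])))) hi
  refine h2.trans (hle.trans ?_)
  rw [div_eq_inv_mul]
  exact mul_le_mul_of_nonneg_left hint (by positivity)

end FlatPoint

section Cut

theorem sum_half_pow_rpow_le {s : ℝ} (hs : 0 < s) (J : ℕ) :
    ∑ j ∈ range J, (((1 : ℝ) / 2) ^ j) ^ s ≤ (1 - (1 / 2 : ℝ) ^ s)⁻¹ := by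
  have h1 : (1 / 2 : ℝ) ^ s < 1 := Real.rpow_lt_one (by norm_num) (by norm_num) hs
  have h0 : 0 ≤ (1 / 2 : ℝ) ^ s := by positivity
  rw [← tsum_geometric_of_lt_one h0 h1]
  calc _ = ∑ j ∈ range J, ((1 / 2 : ℝ) ^ s) ^ j := by
        refine sum_congr rfl fun j _ => ?_
        rw [← Real.rpow_natCast, ← Real.rpow_natCast, ← Real.rpow_mul (by norm_num),
          ← Real.rpow_mul (by norm_num), mul_comm]
    _ ≤ _ := (summable_geometric_of_lt_one h0 h1).sum_le_tsum _ fun j _ => by positivity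

theorem half_rpow_sum_pos {s : ℝ} (hs : 0 < s) : 0 < (1 - (1 / 2 : ℝ) ^ s)⁻¹ := by
  have h1 : (1 / 2 : ℝ) ^ s < 1 := Real.rpow_lt_one (by norm_num) (by norm_num) hs
  exact inv_pos.2 (by linarith)

/-- If the square roots of two counts differ by little, the counts differ by little unless the
larger one is small. -/
theorem sq_sub_le_of_sqrt_sub_le {x y κ b : ℝ} (hy : 0 ≤ y) (hyx : y ≤ x) (hκ : 0 ≤ κ)
    (hb : 4 * κ ^ 2 < b) (hbx : b ≤ x - y) (h : √x - √y ≤ κ) : (x - y) ^ 2 ≤ 9 * κ ^ 2 * y := by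
  have hx : 0 ≤ x := hy.trans hyx
  have sx := Real.sq_sqrt hx
  have sy := Real.sq_sqrt hy
  have h0 := Real.sqrt_nonneg x
  have h0' := Real.sqrt_nonneg y
  have h1 : √y ≤ √x := Real.sqrt_le_sqrt hyx
  have h2 : 2 * κ < √x := by
    apply lt_of_pow_lt_pow_left₀ 2 h0
    rw [sx]; nlinarith
  have h3 : √x ≤ 2 * √y := by linarith
  have h4 : x - y = (√x - √y) * (√x + √y) := by nlinarith
  have h5 : x - y ≤ κ * (3 * √y) := by
    rw [h4]
    apply mul_le_mul h (by linarith) (by linarith) hκ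
  calc (x - y) ^ 2 ≤ (κ * (3 * √y)) ^ 2 := pow_le_pow_left₀ (by linarith) h5 2
    _ = 9 * κ ^ 2 * (√y ^ 2) := by ring
    _ = _ := by rw [sy]

variable {V : Type*}

/-- All points at least as close to `u` as `v` belong to `S`. -/
def BallInside (d : V → V → ℝ) (S : Finset V) (u v : V) : Prop :=
  u ≠ v ∧ ∀ x, d u x ≤ d u v → x ∈ S

/-- The pairs whose ball lies in `Z`, but in neither of the two parts of `Z`. -/
noncomputable def cutPairs [Fintype V] (d : V → V → ℝ) (Z A : Finset V) : Finset (V × V) :=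
  univ.filter fun p => BallInside d Z p.1 p.2 ∧ ¬ BallInside d A p.1 p.2 ∧
    ¬ BallInside d (Z \ A) p.1 p.2

theorem exists_cut_flat {Z : Finset V} {L : V → ℝ} {Δ ε γ : ℝ} (hΔ : 0 < Δ) (hε : 0 < ε)
    (hγ1 : γ < 1) (a : ℝ) (J : ℕ) :
    ∃ r, a ≤ r ∧ r ≤ a + ε * Δ ∧ ∀ j ∈ range J,
      √((Z.filter fun z => L z ≤ r + 8 * Δ * (1 / 2) ^ j).card : ℝ) -
        √((Z.filter fun z => L z ≤ r - 8 * Δ * (1 / 2) ^ j).card : ℝ) ≤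
        32 * (1 - (1 / 2 : ℝ) ^ (1 - γ))⁻¹ / ε * ((1 / 2) ^ j) ^ γ * √(Z.card : ℝ) ∧
      √((Z.card : ℝ) - (Z.filter fun z => L z ≤ r - 8 * Δ * (1 / 2) ^ j).card) -
        √((Z.card : ℝ) - (Z.filter fun z => L z ≤ r + 8 * Δ * (1 / 2) ^ j).card) ≤
        32 * (1 - (1 / 2 : ℝ) ^ (1 - γ))⁻¹ / ε * ((1 / 2) ^ j) ^ γ * √(Z.card : ℝ) := by
  set h : ℝ → ℝ := fun r => ((Z.filter fun z => L z ≤ r).card : ℝ) with hh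
  have hmono : Monotone h := by
    intro x y hxy
    simp only [hh]
    exact_mod_cast card_le_card (monotone_filter_right Z fun z _ (hz : L z ≤ x) => hz.trans hxy)
  have hle : ∀ r, h r ≤ Z.card := fun r => by
    simp only [hh]
    exact_mod_cast card_filter_le _ _
  have hnn : ∀ r, 0 ≤ h r := fun r => by simp only [hh]; positivity
  obtain ⟨r, hr1, hr2, hr⟩ := exists_flat_point (ι := ℕ × Bool) (range J ×ˢ univ)
    (φ := fun i r => if i.2 then √(h r) else -√(Z.card - h r))
    (lo := fun i => if i.2 then 0 else -√(Z.card : ℝ)) (m := √(Z.card : ℝ))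
    (c := fun i => (((1 / 2 : ℝ) ^ i.1) ^ γ)⁻¹) (σ := fun i => 8 * Δ * (1 / 2) ^ i.1)
    (by
      rintro ⟨j, _ | _⟩ x y hxy
      · have : √(Z.card - h y) ≤ √(Z.card - h x) := Real.sqrt_le_sqrt (by linarith [hmono hxy])
        simpa using this
      · simpa using Real.sqrt_le_sqrt (hmono hxy))
    (by
      rintro ⟨j, _ | _⟩ r
      · simpa using hnn r
      · simp)
    (by
      rintro ⟨j, _ | _⟩ r
      · simp
      · simpa using Real.sqrt_le_sqrt (hle r))
    (fun i => by positivity) (fun i => by positivity) a (mul_pos hε hΔ)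
  refine ⟨r, hr1, hr2, fun j hj => ?_⟩
  set S := (1 - (1 / 2 : ℝ) ^ (1 - γ))⁻¹ with hS
  have hsum : (∑ i ∈ range J ×ˢ (univ : Finset Bool), (((1 / 2 : ℝ) ^ i.1) ^ γ)⁻¹ *
      (2 * (8 * Δ * (1 / 2) ^ i.1) * √(Z.card : ℝ))) / (ε * Δ) ≤ 32 * S / ε * √(Z.card : ℝ) := by
    have h1 : ∑ i ∈ range J ×ˢ (univ : Finset Bool), (((1 / 2 : ℝ) ^ i.1) ^ γ)⁻¹ *
        (2 * (8 * Δ * (1 / 2) ^ i.1) * √(Z.card : ℝ)) =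
        32 * Δ * √(Z.card : ℝ) * ∑ j ∈ range J, ((1 / 2 : ℝ) ^ j) ^ (1 - γ) := by
      rw [sum_product, mul_sum]
      refine sum_congr rfl fun j _ => ?_
      have hpos : (0 : ℝ) < (1 / 2) ^ j := by positivity
      rw [Real.rpow_sub hpos, Real.rpow_one]
      simp only [sum_const, card_univ, Fintype.card_bool, nsmul_eq_mul]
      push_cast
      field_simp
      ring
    rw [h1, div_le_iff₀ (mul_pos hε hΔ)]
    have h2 := sum_half_pow_rpow_le (by linarith : 0 < 1 - γ) J
    rw [← hS] at h2
    calc _ ≤ 32 * Δ * √(Z.card : ℝ) * S := by gcongr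
      _ = _ := by field_simp
  have hpos : (0 : ℝ) < ((1 / 2 : ℝ) ^ j) ^ γ := by positivity
  have ht := (hr (j, true) (by simpa using hj)).trans hsum
  have hf := (hr (j, false) (by simpa using hj)).trans hsum
  simp only [if_true, if_false, Bool.false_eq_true] at ht hf
  rw [inv_mul_le_iff₀ hpos] at ht hf
  constructor
  · linarith
  · linarith

theorem window_card_sq_le {Z : Finset V} {L : V → ℝ} {r σ κ b : ℝ} (hσ : 0 ≤ σ) (hκ : 0 ≤ κ)
    (h1 : √((Z.filter fun z => L z ≤ r + σ).card : ℝ) -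
      √((Z.filter fun z => L z ≤ r - σ).card : ℝ) ≤ κ * √(Z.card : ℝ))
    (h2 : √((Z.card : ℝ) - (Z.filter fun z => L z ≤ r - σ).card) -
      √((Z.card : ℝ) - (Z.filter fun z => L z ≤ r + σ).card) ≤ κ * √(Z.card : ℝ))
    (hb : 4 * κ ^ 2 * Z.card < b)
    (hbD : b ≤ (Z.filter fun z => r - σ < L z ∧ L z ≤ r + σ).card) :
    ((Z.filter fun z => r - σ < L z ∧ L z ≤ r + σ).card : ℝ) ^ 2 ≤
      18 * κ ^ 2 * ((Z.filter fun z => L z ≤ r).card * (Z \ Z.filter fun z => L z ≤ r).card) := by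
  set x := ((Z.filter fun z => L z ≤ r + σ).card : ℝ) with hx
  set y := ((Z.filter fun z => L z ≤ r - σ).card : ℝ) with hy
  set n := (Z.card : ℝ) with hn
  set α := ((Z.filter fun z => L z ≤ r).card : ℝ) with hα
  set β := ((Z \ Z.filter fun z => L z ≤ r).card : ℝ) with hβ
  have hαβ : β + α = n := by
    rw [hα, hβ, hn]
    exact_mod_cast card_sdiff_add_card_eq_card (filter_subset _ Z)
  have hyα : y ≤ α := by
    rw [hy, hα]
    exact_mod_cast card_le_card
      (monotone_filter_right Z fun z _ (hz : L z ≤ r - σ) => hz.trans (by linarith))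
  have hαx : α ≤ x := by
    rw [hx, hα]
    exact_mod_cast card_le_card
      (monotone_filter_right Z fun z _ (hz : L z ≤ r) => hz.trans (by linarith))
  have hxn : x ≤ n := by rw [hx, hn]; exact_mod_cast card_filter_le _ _
  have hy0 : 0 ≤ y := by rw [hy]; positivity
  have hn0 : 0 ≤ n := by rw [hn]; positivity
  have hD : ((Z.filter fun z => r - σ < L z ∧ L z ≤ r + σ).card : ℝ) = x - y := by
    rw [eq_sub_iff_add_eq, hx, hy, ← Nat.cast_add, ← card_union_of_disjoint]
    · congr 2
      ext z
      simp only [mem_union, mem_filter]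
      constructor
      · rintro (h | h)
        · exact ⟨h.1, h.2.2⟩
        · exact ⟨h.1, by linarith [h.2]⟩
      · rintro ⟨h, h'⟩
        rcases lt_or_ge (r - σ) (L z) with h3 | h3
        · exact Or.inl ⟨h, h3, h'⟩
        · exact Or.inr ⟨h, h3⟩
    · rw [disjoint_filter]
      intro z _ h h'
      linarith [h.1]
  rw [hD] at hbD ⊢
  have hsq : (κ * √n) ^ 2 = κ ^ 2 * n := by rw [mul_pow, Real.sq_sqrt hn0]
  have hκn : 0 ≤ κ * √n := by positivity
  have hb' : 4 * (κ * √n) ^ 2 < b := by rw [hsq]; linarith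
  have e1 := sq_sub_le_of_sqrt_sub_le hy0 (by linarith) hκn hb' hbD h1
  have e2 := sq_sub_le_of_sqrt_sub_le (x := n - y) (y := n - x) (by linarith) (by linarith) hκn hb'
    (by linarith) h2
  rw [hsq] at e1 e2
  have e3 : n - y - (n - x) = x - y := by ring
  rw [e3] at e2
  have hκ2 : 0 ≤ 9 * κ ^ 2 := by positivity
  rcases le_total α β with hab | hab
  · have : n * y ≤ 2 * (α * β) := by nlinarith
    nlinarith [mul_le_mul_of_nonneg_left this hκ2]
  · have : n * (n - x) ≤ 2 * (α * β) := by nlinarith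
    nlinarith [mul_le_mul_of_nonneg_left this hκ2]

end Cut

section CutCost

variable {V : Type*} [Fintype V]

theorem cut_window {d : V → V → ℝ} {Z : Finset V} {L : V → ℝ} {r σ : ℝ} {u v : V}
    (hcut : (u, v) ∈ cutPairs d Z (Z.filter fun z => L z ≤ r)) (hd : 4 * d u v ≤ σ)
    (hL : ∀ x, d u x ≤ d u v → |L x - L u| ≤ 2 * d u v) :
    ∀ x, d u x ≤ d u v → x ∈ Z.filter fun z => r - σ < L z ∧ L z ≤ r + σ := by
  obtain ⟨-, hZ, hA, hB⟩ := mem_filter.1 hcut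
  simp only [BallInside, not_and, not_forall] at hA hB
  obtain ⟨x, hx, hxA⟩ := hA hZ.1
  obtain ⟨x', hx', hxB⟩ := hB hZ.1
  have h1 : r < L x := by
    by_contra h
    exact hxA (mem_filter.2 ⟨hZ.2 x hx, not_lt.1 h⟩)
  have h2 : L x' ≤ r := by
    by_contra h
    exact hxB (mem_sdiff.2 ⟨hZ.2 x' hx', fun h' => h (mem_filter.1 h').2⟩)
  intro y hy
  have h3 := abs_le.1 (hL x hx)
  have h4 := abs_le.1 (hL x' hx')
  have h5 := abs_le.1 (hL y hy)
  exact mem_filter.2 ⟨hZ.2 y hy, by linarith, by linarith⟩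

theorem rpow_le_of_ballCard_le {q γ Δ δ θ κ n b : ℝ} (hq : 0 < q) (hγ : 0 < γ) (hδ : 0 < δ)
    (hΔ : 0 < Δ) (hθ : 0 < θ) (hθδ : Δ * θ < δ) (hb : 0 < b)
    (h : b ≤ 4 * (κ * θ ^ γ) ^ 2 * n) :
    (4 * Δ / δ) ^ q ≤ 4 ^ q * (4 * κ ^ 2 * n / b) ^ (q / (2 * γ)) := by
  have h1 : 4 * Δ / δ ≤ 4 * θ⁻¹ := by
    rw [div_le_iff₀ hδ, mul_assoc]
    gcongr
    rw [inv_mul_eq_div, le_div_iff₀ hθ]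
    exact hθδ.le
  have hsq : (θ ^ γ) ^ 2 = θ ^ (2 * γ) := by
    rw [← Real.rpow_natCast, ← Real.rpow_mul hθ.le]
    congr 1; push_cast; ring
  have h2 : (θ⁻¹) ^ (2 * γ) ≤ 4 * κ ^ 2 * n / b := by
    rw [Real.inv_rpow hθ.le, le_div_iff₀ hb, inv_mul_le_iff₀ (by positivity)]
    rw [mul_pow, hsq] at h
    linarith
  have h3 : (θ⁻¹) ^ q = ((θ⁻¹) ^ (2 * γ)) ^ (q / (2 * γ)) := by
    rw [← Real.rpow_mul (by positivity)]
    congr 1; field_simp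
  calc (4 * Δ / δ) ^ q ≤ (4 * θ⁻¹) ^ q := Real.rpow_le_rpow (by positivity) h1 hq.le
    _ = 4 ^ q * (θ⁻¹) ^ q := Real.mul_rpow (by norm_num) (by positivity)
    _ ≤ _ := by
      rw [h3]
      gcongr

/-- Cutting a set `Z` at a well-chosen threshold of `L`, the cost of the separated pairs is bounded
by a term depending only on the pairs and a term proportional to the product of the sizes of the
two parts. -/
theorem exists_cut {q γ : ℝ} (hq : 0 < q) (hγq : q < 2 * γ) (hγ1 : γ < 1) :
    ∃ C₁ C₂ : ℝ, 0 < C₁ ∧ 0 < C₂ ∧ ∀ {V : Type} [Fintype V] (d : V → V → ℝ) (Z : Finset V)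
      (L : V → ℝ) (Δ ε a : ℝ), 0 < Δ → 0 < ε → (∀ u, d u u = 0) →
      (∀ u v, BallInside d Z u v → 0 < d u v ∧ d u v ≤ 2 * Δ) →
      (∀ u v, BallInside d Z u v → ∀ x, d u x ≤ d u v → |L x - L u| ≤ 2 * d u v) →
      ∃ r, a ≤ r ∧ r ≤ a + ε * Δ ∧
        ∑ p ∈ cutPairs d Z (Z.filter fun z => L z ≤ r), (4 * Δ / d p.1 p.2) ^ q ≤
          ∑ p ∈ cutPairs d Z (Z.filter fun z => L z ≤ r),
            C₁ * ((Z.card : ℝ) / ε ^ 2 / ballCard d p.1 p.2) ^ (q / (2 * γ)) +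
          C₂ / ε ^ 2 * ((Z.filter fun z => L z ≤ r).card *
            (Z \ Z.filter fun z => L z ≤ r).card) := by
  have hγ : 0 < γ := by linarith
  obtain ⟨S, hS⟩ : ∃ S : ℝ, S = 32 * (1 - (1 / 2 : ℝ) ^ (1 - γ))⁻¹ := ⟨_, rfl⟩
  have hS0 : 0 < S := by
    have := half_rpow_sum_pos (by linarith : 0 < 1 - γ)
    rw [hS]; positivity
  obtain ⟨S₂, hS₂⟩ : ∃ S : ℝ, S = (1 - (1 / 2 : ℝ) ^ (2 * γ - q))⁻¹ := ⟨_, rfl⟩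
  have hS₂0 : 0 < S₂ := by rw [hS₂]; exact half_rpow_sum_pos (by linarith)
  refine ⟨4 ^ q * (4 * S ^ 2) ^ (q / (2 * γ)), 4 ^ q * 18 * S ^ 2 * S₂, by positivity,
    by positivity, ?_⟩
  intro V _ d Z L Δ ε a hΔ hε hself hd hL
  have hscale : ∀ p : V × V, ∃ j : ℕ, BallInside d Z p.1 p.2 →
      Δ * (1 / 2) ^ j < d p.1 p.2 ∧ d p.1 p.2 ≤ 2 * Δ * (1 / 2) ^ j := by
    intro p
    by_cases hp : BallInside d Z p.1 p.2
    · obtain ⟨h0, h1⟩ := hd _ _ hp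
      have hΔ2 : 0 < 2 * Δ := by linarith
      obtain ⟨j, hj1, hj2⟩ := exists_nat_pow_near_of_lt_one (div_pos h0 hΔ2)
        ((div_le_one hΔ2).2 h1) (by norm_num : (0 : ℝ) < 1 / 2) (by norm_num)
      rw [lt_div_iff₀ hΔ2, pow_succ] at hj1
      rw [div_le_iff₀ hΔ2] at hj2
      exact ⟨j, fun _ => ⟨by linarith, by linarith⟩⟩
    · exact ⟨0, fun h => absurd h hp⟩
  choose jj hjj using hscale
  obtain ⟨J, hJ⟩ : ∃ J, ∀ p, jj p < J :=
    ⟨univ.sup jj + 1, fun p => Nat.lt_succ_of_le (le_sup (mem_univ p))⟩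
  obtain ⟨r, hr1, hr2, hr⟩ := exists_cut_flat (Z := Z) (L := L) hΔ hε hγ1 a J
  rw [← hS] at hr
  refine ⟨r, hr1, hr2, ?_⟩
  set A := Z.filter fun z => L z ≤ r with hA
  set κ := S / ε with hκ
  have hκ0 : 0 < κ := div_pos hS0 hε
  let win : ℕ → Finset V := fun j =>
    Z.filter fun z => r - 8 * Δ * (1 / 2) ^ j < L z ∧ L z ≤ r + 8 * Δ * (1 / 2) ^ j
  let bd : ℕ → ℝ := fun j => 18 * (κ * ((1 / 2) ^ j) ^ γ) ^ 2 * (A.card * (Z \ A).card)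
  let W : ℕ → Finset (V × V) := fun j => if ((win j).card : ℝ) ^ 2 ≤ bd j then win j ×ˢ win j else ∅
  have hbd : ∀ j, 0 ≤ bd j := fun j => by positivity
  have hWcard : ∀ j, ((W j).card : ℝ) ≤ bd j := by
    intro j
    simp only [W]
    split_ifs with h
    · rw [card_product, Nat.cast_mul, ← sq]; exact h
    · simpa using hbd j
  have hterm : ∀ p ∈ cutPairs d Z A, (4 * Δ / d p.1 p.2) ^ q ≤
      4 ^ q * (4 * S ^ 2) ^ (q / (2 * γ)) *
        ((Z.card : ℝ) / ε ^ 2 / ballCard d p.1 p.2) ^ (q / (2 * γ)) +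
      ∑ j ∈ range J, if p ∈ W j then (4 * ((1 / 2 : ℝ) ^ j)⁻¹) ^ q else 0 := by
    rintro ⟨u, v⟩ hp
    have hZ : BallInside d Z u v := (mem_filter.1 hp).2.1
    obtain ⟨hj1, hj2⟩ := hjj (u, v) hZ
    set j := jj (u, v) with hjdef
    have hjJ : j ∈ range J := mem_range.2 (hJ _)
    simp only at hj1 hj2 ⊢
    have hδ := (hd u v hZ).1
    have hball := cut_window (σ := 8 * Δ * (1 / 2) ^ j) hp (by linarith) (hL u v hZ)
    have hθ : (0 : ℝ) < (1 / 2) ^ j := by positivity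
    have hbc : (0 : ℝ) < ballCard d u v := by exact_mod_cast ballCard_pos d u v
    have hbcwin : (ballCard d u v : ℝ) ≤ (win j).card := by
      have : ballCard d u v ≤ (win j).card :=
        card_le_card fun x hx => hball x (mem_filter.1 hx).2
      exact_mod_cast this
    have hsum0 : ∀ i ∈ range J, 0 ≤ if (u, v) ∈ W i then (4 * ((1 / 2 : ℝ) ^ i)⁻¹) ^ q else 0 := by
      intro i _
      split_ifs
      · positivity
      · exact le_rfl
    by_cases hdense : 4 * (κ * ((1 / 2) ^ j) ^ γ) ^ 2 * Z.card < ballCard d u v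
    · have hw : ((win j).card : ℝ) ^ 2 ≤ bd j :=
        window_card_sq_le (by positivity) (by positivity) (hr j hjJ).1 (hr j hjJ).2 hdense hbcwin
      have huv : (u, v) ∈ W j := by
        simp only [W, if_pos hw]
        exact mem_product.2 ⟨hball u (by rw [hself]; exact hδ.le), hball v le_rfl⟩
      have hle : (4 * Δ / d u v) ^ q ≤ (4 * ((1 / 2 : ℝ) ^ j)⁻¹) ^ q := by
        apply Real.rpow_le_rpow (by positivity) _ hq.le
        rw [div_le_iff₀ hδ, mul_assoc]
        gcongr
        rw [inv_mul_eq_div, le_div_iff₀ hθ]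
        exact hj1.le
      have hs := single_le_sum hsum0 hjJ
      rw [if_pos huv] at hs
      have : 0 ≤ 4 ^ q * (4 * S ^ 2) ^ (q / (2 * γ)) *
        ((Z.card : ℝ) / ε ^ 2 / ballCard d u v) ^ (q / (2 * γ)) := by positivity
      linarith
    · have h1 := rpow_le_of_ballCard_le hq hγ hδ hΔ hθ hj1 hbc (not_lt.1 hdense)
      have h2 : 4 * κ ^ 2 * (Z.card : ℝ) / ballCard d u v =
          (4 * S ^ 2) * ((Z.card : ℝ) / ε ^ 2 / ballCard d u v) := by
        rw [hκ, div_pow]; field_simp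
      rw [h2, Real.mul_rpow (by positivity) (by positivity), ← mul_assoc] at h1
      have := sum_nonneg hsum0
      linarith
  refine (sum_le_sum hterm).trans ?_
  rw [sum_add_distrib]
  gcongr
  rw [sum_comm]
  calc _ ≤ ∑ j ∈ range J, bd j * (4 * ((1 / 2 : ℝ) ^ j)⁻¹) ^ q := by
        apply sum_le_sum
        intro j _
        rw [← sum_filter, sum_const, nsmul_eq_mul]
        gcongr
        refine le_trans ?_ (hWcard j)
        exact_mod_cast card_le_card fun p hp => (mem_filter.1 hp).2
    _ = 4 ^ q * 18 * S ^ 2 / ε ^ 2 * (A.card * (Z \ A).card) *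
        ∑ j ∈ range J, ((1 / 2 : ℝ) ^ j) ^ (2 * γ - q) := by
        rw [mul_sum]
        refine sum_congr rfl fun j _ => ?_
        have hθ : (0 : ℝ) < (1 / 2) ^ j := by positivity
        have hsq : (((1 / 2 : ℝ) ^ j) ^ γ) ^ 2 = ((1 / 2 : ℝ) ^ j) ^ (2 * γ) := by
          rw [← Real.rpow_natCast, ← Real.rpow_mul hθ.le]
          congr 1; push_cast; ring
        simp only [bd]
        rw [Real.mul_rpow (by norm_num) (by positivity), Real.inv_rpow hθ.le, mul_pow, hsq,
          Real.rpow_sub hθ, hκ]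
        field_simp
    _ ≤ 4 ^ q * 18 * S ^ 2 / ε ^ 2 * (A.card * (Z \ A).card) * S₂ := by
        gcongr
        rw [hS₂]
        exact sum_half_pow_rpow_le (by linarith) J
    _ = _ := by ring

end CutCost

section Cost

variable {V : Type*}

/-- The pairs whose ball lies in `S`. -/
noncomputable def alivePairs [Fintype V] (d : V → V → ℝ) (S : Finset V) : Finset (V × V) :=
  univ.filter fun p => BallInside d S p.1 p.2

theorem BallInside.mono {d : V → V → ℝ} {S S' : Finset V} {u v : V} (h : BallInside d S u v)
    (hS : S ⊆ S') : BallInside d S' u v :=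
  ⟨h.1, fun x hx => hS (h.2 x hx)⟩

theorem BallInside.right_mem {d : V → V → ℝ} {S : Finset V} {u v : V} (h : BallInside d S u v) :
    v ∈ S := h.2 v le_rfl

/-- The pairs whose ball lies in `X` admit upper bounds `τ` satisfying `P` of bounded total
cost. -/
def CostBounded [Fintype V] (d : V → V → ℝ) (q : ℝ) (f : V × V → ℝ) (X : Finset V)
    (P : V → V → ℝ → Prop) (B : ℝ) : Prop :=
  ∃ τ : V → V → ℝ, (∀ u v, BallInside d X u v → P u v (τ u v)) ∧
    ∑ p ∈ alivePairs d X, (τ p.1 p.2 / d p.1 p.2) ^ q ≤ ∑ p ∈ alivePairs d X, f p + B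

variable [Fintype V] {d : V → V → ℝ} {q : ℝ} {f : V × V → ℝ}

theorem CostBounded.mono {X : Finset V} {P P' : V → V → ℝ → Prop} {B : ℝ}
    (h : CostBounded d q f X P B)
    (hP : ∀ u v s, BallInside d X u v → P u v s → P' u v s) : CostBounded d q f X P' B := by
  obtain ⟨τ, h1, h2⟩ := h
  exact ⟨τ, fun u v huv => hP u v _ huv (h1 u v huv), h2⟩

theorem sum_alivePairs_eq {Z A : Finset V} (hA : A ⊆ Z) (g : V × V → ℝ) :
    ∑ p ∈ alivePairs d Z, g p = ∑ p ∈ alivePairs d A, g p + ∑ p ∈ alivePairs d (Z \ A), g p +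
      ∑ p ∈ cutPairs d Z A, g p := by
  rw [← sum_union, ← sum_union]
  · refine sum_congr ?_ fun _ _ => rfl
    ext ⟨u, v⟩
    simp only [alivePairs, cutPairs, mem_union, mem_filter, mem_univ, true_and]
    have h1 : BallInside d A u v → BallInside d Z u v := fun h => h.mono hA
    have h2 : BallInside d (Z \ A) u v → BallInside d Z u v := fun h => h.mono sdiff_subset
    tauto
  · rw [disjoint_left]
    rintro ⟨u, v⟩ h1 h2
    simp only [alivePairs, cutPairs, mem_union, mem_filter, mem_univ, true_and] at h1 h2
    tauto
  · rw [disjoint_left]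
    rintro ⟨u, v⟩ h1 h2
    exact (mem_sdiff.1 (mem_filter.1 h2).2.right_mem).2 (mem_filter.1 h1).2.right_mem

theorem CostBounded.merge {Z A : Finset V} {P : V → V → ℝ → Prop} {B₁ B₂ B c : ℝ} (hA : A ⊆ Z)
    (h1 : CostBounded d q f A P B₁) (h2 : CostBounded d q f (Z \ A) P B₂)
    (hP : ∀ u v, BallInside d Z u v → P u v c)
    (hcut : ∑ p ∈ cutPairs d Z A, (c / d p.1 p.2) ^ q ≤
      ∑ p ∈ cutPairs d Z A, f p + (B - B₁ - B₂)) : CostBounded d q f Z P B := by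
  obtain ⟨τ₁, h11, h12⟩ := h1
  obtain ⟨τ₂, h21, h22⟩ := h2
  refine ⟨fun u v => if BallInside d A u v then τ₁ u v else
    if BallInside d (Z \ A) u v then τ₂ u v else c, fun u v huv => ?_, ?_⟩
  · dsimp only
    split_ifs with h h'
    · exact h11 u v h
    · exact h21 u v h'
    · exact hP u v huv
  · rw [sum_alivePairs_eq hA, sum_alivePairs_eq hA f]
    have e1 : ∀ p ∈ alivePairs d A, BallInside d A p.1 p.2 := fun p hp => (mem_filter.1 hp).2
    have e2 : ∀ p ∈ alivePairs d (Z \ A),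
        BallInside d (Z \ A) p.1 p.2 ∧ ¬ BallInside d A p.1 p.2 := fun p hp =>
      ⟨(mem_filter.1 hp).2, fun h => (mem_sdiff.1 (mem_filter.1 hp).2.right_mem).2 h.right_mem⟩
    have e3 : ∀ p ∈ cutPairs d Z A,
        ¬ BallInside d A p.1 p.2 ∧ ¬ BallInside d (Z \ A) p.1 p.2 := fun p hp =>
      (mem_filter.1 hp).2.2
    have s1 : ∀ p ∈ alivePairs d A, (if BallInside d A p.1 p.2 then τ₁ p.1 p.2 else
        if BallInside d (Z \ A) p.1 p.2 then τ₂ p.1 p.2 else c) = τ₁ p.1 p.2 := fun p hp =>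
      if_pos (e1 p hp)
    have s2 : ∀ p ∈ alivePairs d (Z \ A), (if BallInside d A p.1 p.2 then τ₁ p.1 p.2 else
        if BallInside d (Z \ A) p.1 p.2 then τ₂ p.1 p.2 else c) = τ₂ p.1 p.2 := fun p hp => by
      rw [if_neg (e2 p hp).2, if_pos (e2 p hp).1]
    have s3 : ∀ p ∈ cutPairs d Z A, (if BallInside d A p.1 p.2 then τ₁ p.1 p.2 else
        if BallInside d (Z \ A) p.1 p.2 then τ₂ p.1 p.2 else c) = c := fun p hp => by
      rw [if_neg (e3 p hp).1, if_neg (e3 p hp).2]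
    have c1 := sum_congr (s₁ := alivePairs d A) rfl fun p hp =>
      congrArg (fun x => (x / d p.1 p.2) ^ q) (s1 p hp)
    have c2 := sum_congr (s₁ := alivePairs d (Z \ A)) rfl fun p hp =>
      congrArg (fun x => (x / d p.1 p.2) ^ q) (s2 p hp)
    have c3 := sum_congr (s₁ := cutPairs d Z A) rfl fun p hp =>
      congrArg (fun x => (x / d p.1 p.2) ^ q) (s3 p hp)
    dsimp only at c1 c2 c3 ⊢
    rw [c1, c2, c3]
    linarith

/-- Every set `Z ⊆ X` can be cut at a threshold of `L` in a window of width proportional to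
`t X.card`, the separated pairs being paid for by `f` and by the decrease of `Φ`. -/
def HasCheapCuts (d : V → V → ℝ) (q : ℝ) (f : V × V → ℝ) (t Φ : ℕ → ℝ) : Prop :=
  ∀ (X Z : Finset V) (L : V → ℝ) (Δ a : ℝ), Z ⊆ X → X.Nonempty → 0 < Δ →
    (∀ u v, BallInside d Z u v → 0 < d u v ∧ d u v ≤ 2 * Δ) →
    (∀ u v, BallInside d Z u v → ∀ x, d u x ≤ d u v → |L x - L u| ≤ 2 * d u v) →
    ∃ r, a ≤ r ∧ r ≤ a + t X.card / 64 * Δ ∧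
      ∑ p ∈ cutPairs d Z (Z.filter fun z => L z ≤ r), (4 * Δ / d p.1 p.2) ^ q ≤
        ∑ p ∈ cutPairs d Z (Z.filter fun z => L z ≤ r), f p +
          (Φ Z.card - Φ (Z.filter fun z => L z ≤ r).card - Φ (Z \ Z.filter fun z => L z ≤ r).card)

theorem mul_le_add_mul_sqrt {a b : ℝ} (ha : 0 ≤ a) (hb : 0 ≤ b) :
    a * b ≤ √(a + b) * ((a + b) * √(a + b) - a * √a - b * √b) := by
  have h1 := Real.sq_sqrt ha
  have h2 := Real.sq_sqrt hb
  have h3 := Real.sq_sqrt (add_nonneg ha hb)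
  have h4 : √a ≤ √(a + b) := Real.sqrt_le_sqrt (by linarith)
  have h5 : √b ≤ √(a + b) := Real.sqrt_le_sqrt (by linarith)
  have n1 := Real.sqrt_nonneg a
  have n2 := Real.sqrt_nonneg b
  have n3 := Real.sqrt_nonneg (a + b)
  set x := √a
  set y := √b
  set s := √(a + b)
  have e1 : b ≤ 2 * (s * (s - x)) := by nlinarith
  have e2 : a ≤ 2 * (s * (s - y)) := by nlinarith
  have := mul_le_mul_of_nonneg_left e1 ha
  have := mul_le_mul_of_nonneg_left e2 hb
  nlinarith

theorem exists_hasCheapCuts {q : ℝ} (hq : 0 < q) (hq2 : q < 2) :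
    ∃ β C C' : ℝ, 0 < β ∧ β < 1 ∧ 0 < C ∧ 0 < C' ∧ ∀ {V : Type} [Fintype V] (d : V → V → ℝ),
      (∀ u, d u u = 0) →
      HasCheapCuts d q (fun p => C * ((Fintype.card V : ℝ) / ballCard d p.1 p.2) ^ β)
        (fun m => √√((m : ℝ) / Fintype.card V))
        (fun m => C' * √(Fintype.card V : ℝ) * (m * √(m : ℝ))) := by
  obtain ⟨γ, hγq, hγ1⟩ : ∃ γ, q / 2 < γ ∧ γ < 1 := exists_between (by linarith)
  have hγ : 0 < γ := by linarith
  obtain ⟨C₁, C₂, hC₁, hC₂, hcut⟩ := exists_cut hq (by linarith : q < 2 * γ) hγ1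
  refine ⟨q / (2 * γ), C₁ * 4096 ^ (q / (2 * γ)), 4096 * C₂, by positivity,
    (div_lt_one (by positivity)).2 (by linarith), by positivity, by positivity, ?_⟩
  intro V _ d hself X Z L Δ a hZX hX hΔ hd hL
  obtain ⟨n, hn⟩ : ∃ n : ℝ, n = X.card := ⟨_, rfl⟩
  obtain ⟨N, hN⟩ : ∃ N : ℝ, N = Fintype.card V := ⟨_, rfl⟩
  have hn0 : 0 < n := by rw [hn]; exact_mod_cast hX.card_pos
  have hnN : n ≤ N := by rw [hn, hN]; exact_mod_cast card_le_univ X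
  have hN0 : 0 < N := hn0.trans_le hnN
  have hε : 0 < √√(n / N) / 64 := by positivity
  have hε2 : (√√(n / N) / 64) ^ 2 = √n / √N / 4096 := by
    rw [div_pow, Real.sq_sqrt (Real.sqrt_nonneg _), Real.sqrt_div hn0.le]; norm_num
  obtain ⟨r, h1, h2, h3⟩ := hcut d Z L Δ (√√(n / N) / 64) a hΔ hε hself hd hL
  rw [← hN]
  dsimp only
  rw [← hn]
  refine ⟨r, h1, h2, h3.trans ?_⟩
  have hn' : 0 < √n := Real.sqrt_pos.2 hn0
  have hN' : 0 < √N := Real.sqrt_pos.2 hN0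
  have hnN' : √n ≤ √N := Real.sqrt_le_sqrt hnN
  have hsn := Real.mul_self_sqrt hn0.le
  have hsN := Real.mul_self_sqrt hN0.le
  have hZn : (Z.card : ℝ) ≤ n := by rw [hn]; exact_mod_cast card_le_card hZX
  rw [hε2]
  apply add_le_add
  · refine sum_le_sum fun p _ => ?_
    have hbc : (0 : ℝ) < ballCard d p.1 p.2 := by exact_mod_cast ballCard_pos d p.1 p.2
    rw [mul_assoc, ← Real.mul_rpow (by norm_num) (by positivity), ← mul_div_assoc]
    gcongr
    rw [div_div_eq_mul_div, div_div_eq_mul_div, div_le_iff₀ hn']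
    nlinarith [mul_le_mul_of_nonneg_left hnN' hN'.le, mul_le_mul_of_nonneg_right hZn hN'.le,
      mul_le_mul_of_nonneg_left hnN' (mul_pos hN' hn').le]
  · set α := ((Z.filter fun z => L z ≤ r).card : ℝ) with hα
    set β := ((Z \ Z.filter fun z => L z ≤ r).card : ℝ) with hβ
    have hαβ : α + β = Z.card := by
      rw [hα, hβ, add_comm]
      exact_mod_cast card_sdiff_add_card_eq_card (filter_subset _ Z)
    have hα0 : 0 ≤ α := by positivity
    have hβ0 : 0 ≤ β := by positivity
    have h4 := mul_le_add_mul_sqrt hα0 hβ0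
    rw [hαβ] at h4
    have h5 : √(Z.card : ℝ) ≤ √n := Real.sqrt_le_sqrt hZn
    have h6 : 0 ≤ Z.card * √(Z.card : ℝ) - α * √α - β * √β := by
      have h7 : √α ≤ √(Z.card : ℝ) := Real.sqrt_le_sqrt (by linarith)
      have h8 : √β ≤ √(Z.card : ℝ) := Real.sqrt_le_sqrt (by linarith)
      rw [← hαβ] at h7 h8 ⊢
      nlinarith [mul_le_mul_of_nonneg_left h7 hα0, mul_le_mul_of_nonneg_left h8 hβ0]
    have h7 := h4.trans (mul_le_mul_of_nonneg_right h5 h6)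
    calc C₂ / (√n / √N / 4096) * (α * β)
        ≤ C₂ / (√n / √N / 4096) * (√n * (Z.card * √(Z.card : ℝ) - α * √α - β * √β)) := by gcongr
      _ = _ := by field_simp

end Cost

section Potential

variable {V : Type*} {H : SimpleGraph V} {w : Sym2 V → ℝ}

theorem reachWithin_of_parents (hw : ∀ e ∈ H.edgeSet, 0 < w e) {X : Finset V} {D : V → ℝ} {x₀ : V}
    (h0 : D x₀ = 0)
    (hpar : ∀ z ∈ X, z ≠ x₀ → ∃ y ∈ X, H.Adj y z ∧ D z = D y + w s(y, z)) :
    ∀ z ∈ X, ReachWithin H w x₀ z (D z) := by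
  by_contra! hbad
  obtain ⟨z₀, hz₀, hz₀'⟩ := hbad
  obtain ⟨z, hz, hmin⟩ := exists_min_image (X.filter fun z => ¬ ReachWithin H w x₀ z (D z)) D
    ⟨z₀, mem_filter.2 ⟨hz₀, hz₀'⟩⟩
  obtain ⟨hzX, hzr⟩ := mem_filter.1 hz
  have hne : z ≠ x₀ := by
    rintro rfl
    exact hzr (h0 ▸ .refl H w z le_rfl)
  obtain ⟨y, hy, hyz, he⟩ := hpar z hzX hne
  by_cases hyr : ReachWithin H w x₀ y (D y)
  · exact hzr (he ▸ hyr.trans (.of_adj hyz))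
  · have := hmin y (mem_filter.2 ⟨hy, hyr⟩)
    have := hw s(y, z) hyz
    linarith

theorem abs_sub_le_of_ballInside [Fintype V] (hw : ∀ e ∈ H.edgeSet, 0 < w e) (hH : H.Connected)
    {Z : Finset V} {L : V → ℝ} (hL : ∀ a ∈ Z, ∀ b ∈ Z, H.Adj a b → L b ≤ L a + 2 * w s(a, b))
    {u v : V} (hZ : BallInside (wdist H w) Z u v) :
    ∀ x, wdist H w u x ≤ wdist H w u v → |L x - L u| ≤ 2 * wdist H w u v := by
  have key : ∀ x, wdist H w u x ≤ wdist H w u v → |L x - L u| ≤ 2 * wdist H w u x := by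
    by_contra! hbad
    obtain ⟨z₀, hz₀, hz₀'⟩ := hbad
    obtain ⟨z, hz, hmin⟩ := exists_min_image (univ.filter fun z =>
      wdist H w u z ≤ wdist H w u v ∧ 2 * wdist H w u z < |L z - L u|) (wdist H w u)
      ⟨z₀, mem_filter.2 ⟨mem_univ _, hz₀, hz₀'⟩⟩
    obtain ⟨-, hzX, hzr⟩ := mem_filter.1 hz
    have hne : z ≠ u := by
      rintro rfl
      simp [wdist_self hw] at hzr
    obtain ⟨y, hy, -, he⟩ := exists_adj_wdist_eq hw (hH u z) hne
    have hpos := hw s(y, z) hy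
    have hyv : wdist H w u y ≤ wdist H w u v := by linarith
    by_cases hyr : |L y - L u| ≤ 2 * wdist H w u y
    · have h1 := hL y (hZ.2 y hyv) z (hZ.2 z hzX) hy
      have h2 := hL z (hZ.2 z hzX) y (hZ.2 y hyv) hy.symm
      rw [Sym2.eq_swap] at h2
      have h3 := abs_le.1 hyr
      refine absurd (abs_le.2 ⟨?_, ?_⟩) (not_le.2 hzr) <;> linarith
    · have := hmin y (mem_filter.2 ⟨mem_univ _, hyv, not_le.1 hyr⟩)
      linarith
  exact fun x hx => (key x hx).trans (by linarith)

end Potential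

section Tree

variable {V : Type*} [Fintype V]

/-- Whenever `D` is a distance-like potential on `X` with root `x₀`, there is a tree on `X` that
nearly preserves `D` and has bounded total cost. -/
def HasGoodTrees (H : SimpleGraph V) (w : Sym2 V → ℝ) (q : ℝ) (f : V × V → ℝ) (t Φ : ℕ → ℝ)
    (X : Finset V) : Prop :=
  ∀ x₀ ∈ X, ∀ (D : V → ℝ) (Δ : ℝ), D x₀ = 0 →
    (∀ a ∈ X, ∀ b ∈ X, H.Adj a b → D b ≤ D a + w s(a, b)) →
    (∀ z ∈ X, z ≠ x₀ → ∃ y ∈ X, H.Adj y z ∧ D z = D y + w s(y, z)) →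
    (∀ z ∈ X, D z ≤ Δ) →
    ∃ T ≤ H, T.edgeSet.ncard + 1 ≤ X.card ∧
      (∀ z ∈ X, ReachWithin T w x₀ z (D z + t X.card * Δ)) ∧
      CostBounded (wdist H w) q f X (ReachWithin T w) (Φ X.card)

variable {H : SimpleGraph V} {w : Sym2 V → ℝ} {q : ℝ} {f : V × V → ℝ} {t Φ : ℕ → ℝ}

theorem exists_cones (hw : ∀ e ∈ H.edgeSet, 0 < w e) (hH : H.Connected)
    (hΦ : ∀ m, 0 ≤ Φ m) (hcut : HasCheapCuts (wdist H w) q f t Φ) {X A : Finset V}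
    (hX : X.Nonempty) {D : V → ℝ} {Δ r₀ B : ℝ} (hΔ : 0 < Δ)
    (hIH : ∀ C ⊆ X \ A, HasGoodTrees H w q f t Φ C)
    (hD : ∀ a ∈ X, ∀ b ∈ X, H.Adj a b → D b ≤ D a + w s(a, b))
    (hDΔ : ∀ z ∈ X, D z ≤ Δ) (hDr : ∀ z ∈ X \ A, r₀ ≤ D z)
    (hdiam : ∀ u v, BallInside (wdist H w) X u v → 0 < wdist H w u v ∧ wdist H w u v ≤ 2 * Δ)
    (hB : ∀ C ⊆ X \ A, t X.card / 64 * Δ + t C.card * (Δ - r₀ + t X.card / 64 * Δ) ≤ B)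
    (Z : Finset V) (hZX : Z ⊆ X \ A)
    (hpar : ∀ z ∈ Z, ∃ y, (y ∈ A ∨ y ∈ Z) ∧ H.Adj y z ∧ D z = D y + w s(y, z)) :
    ∃ T ≤ H, T.edgeSet.ncard ≤ Z.card ∧
      (∀ z ∈ Z, ∃ y ∈ A, ReachWithin T w y z (D z - D y + B)) ∧
      CostBounded (wdist H w) q f Z (fun u v s => ReachWithin T w u v s ∨ 4 * Δ ≤ s)
        (Φ Z.card) := by
  induction Z using Finset.strongInduction with
  | H Z ih =>
  rcases Z.eq_empty_or_nonempty with rfl | hZ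
  · refine ⟨⊥, bot_le, by simp, by simp, fun _ _ => 4 * Δ, fun _ _ _ => Or.inr le_rfl, ?_⟩
    have : alivePairs (wdist H w) ∅ = ∅ := by
      ext ⟨u, v⟩
      simp only [alivePairs, mem_filter, notMem_empty, iff_false]
      exact fun h => absurd h.2.right_mem (notMem_empty v)
    rw [this]
    simpa using hΦ 0
  have hZX' : Z ⊆ X := hZX.trans sdiff_subset
  obtain ⟨p, hp, hpmin⟩ := exists_min_image Z D hZ
  obtain ⟨y₀, hy₀, hy₀p, hDp⟩ := hpar p hp
  have hwp := hw s(y₀, p) hy₀p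
  have hy₀A : y₀ ∈ A := by
    refine hy₀.resolve_right fun h => ?_
    have := hpmin y₀ h
    linarith
  let K : SimpleGraph V :=
    { Adj := fun a b => H.Adj a b ∧ a ∈ Z ∧ b ∈ Z
      symm := ⟨fun a b h => ⟨h.1.symm, h.2.2, h.2.1⟩⟩
      loopless := ⟨fun a h => h.1.ne rfl⟩ }
  have hKH : K ≤ H := fun a b h => h.1
  have hwK : ∀ e ∈ K.edgeSet, 0 < w e := fun e he => hw e (SimpleGraph.edgeSet_mono hKH he)
  obtain ⟨ℓ, hℓ⟩ : ∃ ℓ, ℓ = t X.card / 64 * Δ := ⟨_, rfl⟩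
  obtain ⟨F, hF⟩ : ∃ F, F = wdist K w p := ⟨_, rfl⟩
  have hF0 : F p = 0 := by rw [hF]; exact wdist_self hwK p
  have hFlip : ∀ a b, K.Reachable p a → K.Adj a b → F b ≤ F a + w s(a, b) := fun a b ha hab => by
    rw [hF]; exact wdist_le_add_of_adj hwK ha hab
  obtain ⟨L, hL⟩ : ∃ L : V → ℝ, L = fun z =>
    if K.Reachable p z then F z - D z + D p else ℓ + 1 := ⟨_, rfl⟩
  have hLr : ∀ z, K.Reachable p z → L z = F z - D z + D p := fun z hz => by rw [hL]; exact if_pos hz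
  have hLn : ∀ z, ¬ K.Reachable p z → L z = ℓ + 1 := fun z hz => by rw [hL]; exact if_neg hz
  have hLlip : ∀ a ∈ Z, ∀ b ∈ Z, H.Adj a b → L b ≤ L a + 2 * w s(a, b) := by
    intro a ha b hb hab
    have hK : K.Adj a b := ⟨hab, ha, hb⟩
    have hpos := hw s(a, b) hab
    by_cases hr : K.Reachable p a
    · have h1 := hFlip a b hr hK
      have h2 := hD b (hZX' hb) a (hZX' ha) hab.symm
      rw [Sym2.eq_swap] at h2
      rw [hLr a hr, hLr b (hr.trans hK.reachable)]
      linarith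
    · rw [hLn a hr, hLn b fun h => hr (h.trans hK.symm.reachable)]
      linarith
  obtain ⟨r, hr0, hrℓ, hr⟩ := hcut X Z L Δ 0 hZX' hX hΔ
    (fun u v huv => hdiam u v (huv.mono hZX'))
    (fun u v huv => abs_sub_le_of_ballInside hw hH hLlip huv)
  rw [zero_add, ← hℓ] at hrℓ
  obtain ⟨C, hC⟩ : ∃ C, C = Z.filter fun z => L z ≤ r := ⟨_, rfl⟩
  rw [← hC] at hr
  have hCmem : ∀ z, z ∈ C ↔ z ∈ Z ∧ K.Reachable p z ∧ F z - D z + D p ≤ r := by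
    intro z
    rw [hC, mem_filter]
    by_cases h : K.Reachable p z
    · rw [hLr z h]; tauto
    · rw [hLn z h]
      constructor
      · rintro ⟨-, h'⟩; linarith
      · tauto
  have hCZ : C ⊆ Z := by rw [hC]; exact filter_subset _ _
  have hpC : p ∈ C := (hCmem p).2 ⟨hp, .refl p, by linarith⟩
  obtain ⟨T₁, hT₁H, hT₁c, hT₁r, hT₁⟩ := hIH C (hCZ.trans hZX) p hpC F (Δ - r₀ + ℓ) hF0
    (fun a ha b hb hab => hFlip a b ((hCmem a).1 ha).2.1 ⟨hab, hCZ ha, hCZ hb⟩)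
    (by
      intro z hz hzp
      obtain ⟨hzZ, hzr, hzL⟩ := (hCmem z).1 hz
      obtain ⟨y, hyz, hpy, he⟩ := exists_adj_wdist_eq hwK hzr hzp
      rw [← hF] at he
      have := hD y (hZX' hyz.2.1) z (hZX' hzZ) hyz.1
      exact ⟨y, (hCmem y).2 ⟨hyz.2.1, hpy, by linarith⟩, hyz.1, he⟩)
    (by
      intro z hz
      obtain ⟨hzZ, hzr, hzL⟩ := (hCmem z).1 hz
      have := hDΔ z (hZX' hzZ)
      have := hDr p (hZX hp)
      linarith)
  have hZC : Z \ C ⊂ Z := sdiff_ssubset hCZ ⟨p, hpC⟩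
  obtain ⟨T₂, hT₂H, hT₂c, hT₂r, hT₂⟩ := ih (Z \ C) hZC (sdiff_subset.trans hZX) (by
    intro z hz
    obtain ⟨hzZ, hzC⟩ := mem_sdiff.1 hz
    obtain ⟨y, hy, hyz, he⟩ := hpar z hzZ
    refine ⟨y, hy.imp_right fun hyZ => mem_sdiff.2 ⟨hyZ, fun hyC => hzC ?_⟩, hyz, he⟩
    obtain ⟨-, hyr, hyL⟩ := (hCmem y).1 hyC
    have hK : K.Adj y z := ⟨hyz, hyZ, hzZ⟩
    have := hFlip y z hyr hK
    exact (hCmem z).2 ⟨hzZ, hyr.trans hK.reachable, by linarith⟩)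
  have h1 : T₁ ≤ T₁ ⊔ T₂ ⊔ SimpleGraph.edge y₀ p := le_sup_left.trans le_sup_left
  have h2 : T₂ ≤ T₁ ⊔ T₂ ⊔ SimpleGraph.edge y₀ p := le_sup_right.trans le_sup_left
  have h3 : SimpleGraph.edge y₀ p ≤ T₁ ⊔ T₂ ⊔ SimpleGraph.edge y₀ p := le_sup_right
  refine ⟨T₁ ⊔ T₂ ⊔ SimpleGraph.edge y₀ p, sup_le (sup_le hT₁H hT₂H)
    ((SimpleGraph.edge_le_iff ..).2 (Or.inr hy₀p)), ?_, ?_, ?_⟩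
  · have hcard := card_sdiff_add_card_eq_card hCZ
    rw [SimpleGraph.edgeSet_sup, SimpleGraph.edgeSet_sup]
    have e1 := Set.ncard_union_le (T₁.edgeSet ∪ T₂.edgeSet) (SimpleGraph.edge y₀ p).edgeSet
    have e2 := Set.ncard_union_le T₁.edgeSet T₂.edgeSet
    have e3 : (SimpleGraph.edge y₀ p).edgeSet.ncard = 1 := by
      rw [SimpleGraph.edgeSet_edge_of_ne hy₀p.ne, Set.ncard_singleton]
    omega
  · intro z hz
    by_cases hzC : z ∈ C
    · obtain ⟨-, hzr, hzL⟩ := (hCmem z).1 hzC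
      have hb := hB C (hCZ.trans hZX)
      rw [← hℓ] at hb
      have hadj : (SimpleGraph.edge y₀ p).Adj y₀ p := by
        simp [SimpleGraph.edge_adj, hy₀p.ne]
      refine ⟨y₀, hy₀A, (((ReachWithin.of_adj hadj).of_le h3).trans
        ((hT₁r z hzC).of_le h1)).mono ?_⟩
      linarith
    · obtain ⟨y, hy, hyz⟩ := hT₂r z (mem_sdiff.2 ⟨hz, hzC⟩)
      exact ⟨y, hy, hyz.of_le h2⟩
  · refine CostBounded.merge hCZ (hT₁.mono fun u v s _ h => Or.inl (h.of_le h1))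
      (hT₂.mono fun u v s _ h => h.imp_left fun h => h.of_le h2) (c := 4 * Δ)
      (fun u v _ => Or.inr le_rfl) ?_
    linarith

theorem cone_budget {tX tA tC M r₀ : ℝ} (h0 : 0 ≤ tX) (h1 : tX ≤ 1) (hM : 0 < M)
    (hr1 : M / 2 ≤ r₀) (hr2 : r₀ ≤ M / 2 + tX / 64 * M) (hA : tA ≤ tX) (hC : tC ≤ tX)
    (h : tA ≤ 0.85 * tX ∨ tC ≤ 0.85 * tX) :
    tX / 64 * M + tC * (M - r₀ + tX / 64 * M) ≤ tX * M - tA * r₀ := by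
  have htM : 0 ≤ tX * M := by positivity
  have htM1 : tX * M ≤ M := by nlinarith
  have h2 : tX * (tX / 64 * M) ≤ tX / 64 * M := by nlinarith
  have hr0 : 0 ≤ r₀ := by linarith
  have hr3 : 0 ≤ M - r₀ + tX / 64 * M := by linarith
  have e1 := mul_le_mul_of_nonneg_left hr1 h0
  have e2 := mul_le_mul_of_nonneg_left hr2 h0
  rcases h with h | h
  · have := mul_le_mul_of_nonneg_right h hr0
    have := mul_le_mul_of_nonneg_right hC hr3
    nlinarith
  · have := mul_le_mul_of_nonneg_right hA hr0
    have := mul_le_mul_of_nonneg_right h hr3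
    nlinarith

theorem hasGoodTrees (hw : ∀ e ∈ H.edgeSet, 0 < w e) (hH : H.Connected)
    (ht0 : ∀ m, 0 < m → 0 < t m) (ht1 : ∀ m, m ≤ Fintype.card V → t m ≤ 1)
    (htm : ∀ m n, m ≤ n → t m ≤ t n) (hth : ∀ m n, 2 * m ≤ n → t m ≤ 0.85 * t n)
    (hΦ : ∀ m, 0 ≤ Φ m) (hcut : HasCheapCuts (wdist H w) q f t Φ) (X : Finset V) :
    HasGoodTrees H w q f t Φ X := by
  induction X using Finset.strongInduction with
  | H X ih =>
  intro x₀ hx₀ D Δ hD0 hD hpar hDΔ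
  have hreach := reachWithin_of_parents hw hD0 hpar
  have hDnn : ∀ z ∈ X, 0 ≤ D z := fun z hz => (hreach z hz).nonneg hw
  have hX : X.Nonempty := ⟨x₀, hx₀⟩
  have htX := ht0 X.card hX.card_pos
  have htX1 := ht1 X.card (card_le_univ X)
  by_cases htriv : ∀ z ∈ X, z = x₀
  · have hX1 : X = {x₀} := eq_singleton_iff_unique_mem.2 ⟨hx₀, htriv⟩
    have hΔ0 : 0 ≤ Δ := hD0 ▸ hDΔ x₀ hx₀
    refine ⟨⊥, bot_le, by simp [hX1], fun z hz => ?_, fun _ _ => 0, fun u v huv => ?_, ?_⟩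
    · rw [htriv z hz, hD0]
      exact .refl _ _ _ (by positivity)
    · exact absurd ((htriv u (huv.2 u (by rw [wdist_self hw]; exact wdist_nonneg hw u v))).trans
        (htriv v huv.right_mem).symm) huv.1
    · have : alivePairs (wdist H w) X = ∅ := by
        ext ⟨u, v⟩
        simp only [alivePairs, mem_filter, notMem_empty, iff_false]
        exact fun h => h.2.1 ((htriv u (h.2.2 u (by
          rw [wdist_self hw]; exact wdist_nonneg hw u v))).trans (htriv v h.2.right_mem).symm)
      rw [this]
      simpa using hΦ X.card
  push Not at htriv
  obtain ⟨x₁, hx₁, hx₁0⟩ := htriv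
  obtain ⟨m, hm, hmmax⟩ := exists_max_image X D hX
  obtain ⟨M, hM⟩ : ∃ M, M = D m := ⟨_, rfl⟩
  rw [← hM] at hmmax
  have hMΔ : M ≤ Δ := hM ▸ hDΔ m hm
  have hM0 : 0 < M := by
    obtain ⟨y, hy, hyx, he⟩ := hpar x₁ hx₁ hx₁0
    have := hDnn y hy
    have := hw s(y, x₁) hyx
    have := hmmax x₁ hx₁
    linarith
  have hmem : ∀ u v, BallInside (wdist H w) X u v → u ∈ X := fun u v huv =>
    huv.2 u (by rw [wdist_self hw]; exact wdist_nonneg hw u v)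
  have hdiam : ∀ u v, BallInside (wdist H w) X u v →
      0 < wdist H w u v ∧ wdist H w u v ≤ 2 * M := by
    intro u v huv
    have hu := hmem u v huv
    have hv := huv.right_mem
    refine ⟨wdist_pos hw (hH u v) huv.1, ?_⟩
    have := wdist_le_of_reachWithin hw ((hreach u hu).symm.trans (hreach v hv))
    have := hmmax u hu
    have := hmmax v hv
    linarith
  obtain ⟨r₀, hr1, hr2, hr⟩ := hcut X X D M (M / 2) subset_rfl hX hM0 hdiam
    (fun u v huv => abs_sub_le_of_ballInside hw hH (fun a ha b hb hab => by
      have := hD a ha b hb hab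
      have := hw s(a, b) hab
      linarith) huv)
  obtain ⟨A, hA⟩ : ∃ A, A = X.filter fun z => D z ≤ r₀ := ⟨_, rfl⟩
  rw [← hA] at hr
  have hAX : A ⊆ X := by rw [hA]; exact filter_subset _ _
  have hAmem : ∀ z, z ∈ A ↔ z ∈ X ∧ D z ≤ r₀ := fun z => by rw [hA, mem_filter]
  have hr0M : r₀ < M := by nlinarith
  have hAss : A ⊂ X := by
    refine Finset.ssubset_iff_subset_ne.2 ⟨hAX, fun h => ?_⟩
    rw [← h] at hm
    have := ((hAmem m).1 hm).2
    linarith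
  have hx₀A : x₀ ∈ A := (hAmem x₀).2 ⟨hx₀, by linarith⟩
  obtain ⟨T₁, hT₁H, hT₁c, hT₁r, hT₁⟩ := ih A hAss x₀ hx₀A D r₀ hD0
    (fun a ha b hb => hD a (hAX ha) b (hAX hb))
    (fun z hz hz0 => by
      obtain ⟨y, hy, hyz, he⟩ := hpar z (hAX hz) hz0
      have := hw s(y, z) hyz
      exact ⟨y, (hAmem y).2 ⟨hy, by linarith [((hAmem z).1 hz).2]⟩, hyz, he⟩)
    (fun z hz => ((hAmem z).1 hz).2)
  have hcard := card_sdiff_add_card_eq_card hAX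
  obtain ⟨T₂, hT₂H, hT₂c, hT₂r, hT₂⟩ := exists_cones (A := A) (r₀ := r₀)
    (B := t X.card * M - t A.card * r₀) hw hH hΦ hcut hX hM0
    (fun C hC => ih C (Finset.ssubset_of_subset_of_ssubset hC (sdiff_ssubset hAX ⟨x₀, hx₀A⟩)))
    hD hmmax
    (fun z hz => by
      by_contra h
      exact (mem_sdiff.1 hz).2 ((hAmem z).2 ⟨(mem_sdiff.1 hz).1, (not_le.1 h).le⟩))
    hdiam
    (fun C hC => by
      have hCc := card_le_card hC
      refine cone_budget htX.le htX1 hM0 hr1 hr2 (htm _ _ (by omega)) (htm _ _ (by omega)) ?_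
      rcases le_or_gt (2 * A.card) X.card with h | h
      · exact Or.inl (hth _ _ h)
      · exact Or.inr (hth _ _ (by omega)))
    (X \ A) subset_rfl
    (fun z hz => by
      obtain ⟨hzX, hzA⟩ := mem_sdiff.1 hz
      obtain ⟨y, hy, hyz, he⟩ := hpar z hzX (by rintro rfl; exact hzA hx₀A)
      refine ⟨y, ?_, hyz, he⟩
      by_cases hyA : y ∈ A
      · exact Or.inl hyA
      · exact Or.inr (mem_sdiff.2 ⟨hy, hyA⟩))
  have htr : t X.card * M ≤ t X.card * Δ := by gcongr
  have hTr : ∀ z ∈ X, ReachWithin (T₁ ⊔ T₂) w x₀ z (D z + t X.card * M) := by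
    intro z hz
    by_cases hzA : z ∈ A
    · refine ((hT₁r z hzA).of_le le_sup_left).mono ?_
      have := mul_le_mul (htm _ _ (card_le_card hAX)) hr0M.le (by linarith) htX.le
      linarith
    · obtain ⟨y, hy, hyz⟩ := hT₂r z (mem_sdiff.2 ⟨hz, hzA⟩)
      refine (((hT₁r y hy).of_le le_sup_left).trans (hyz.of_le le_sup_right)).mono ?_
      linarith
  have hpair : ∀ u v s, BallInside (wdist H w) X u v → 4 * M ≤ s →
      ReachWithin (T₁ ⊔ T₂) w u v s := by
    intro u v s huv hs
    have hu := hmem u v huv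
    have hv := huv.right_mem
    refine ((hTr u hu).symm.trans (hTr v hv)).mono ?_
    have := hmmax u hu
    have := hmmax v hv
    nlinarith
  refine ⟨T₁ ⊔ T₂, sup_le hT₁H hT₂H, ?_, fun z hz => (hTr z hz).mono (by linarith), ?_⟩
  · rw [SimpleGraph.edgeSet_sup]
    have := Set.ncard_union_le T₁.edgeSet T₂.edgeSet
    omega
  · refine CostBounded.merge hAX (hT₁.mono fun u v s _ h => h.of_le le_sup_left)
      (hT₂.mono fun u v s huv h => h.elim (fun h => h.of_le le_sup_right)
        (hpair u v s (huv.mono sdiff_subset))) (fun u v huv => hpair u v _ huv le_rfl) ?_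
    linarith

end Tree

section SpanningTree

theorem sqrt_sqrt_div_le {a b c : ℝ} (ha : 0 ≤ a) (hc : 0 ≤ c) (h : 2 * a ≤ b) :
    √√(a / c) ≤ 0.85 * √√(b / c) := by
  have h1 : a / c ≤ 0.85 ^ 4 * (b / c) := by
    rw [← mul_div_assoc]
    gcongr
    norm_num
    linarith
  have hb : 0 ≤ b := by linarith
  calc √√(a / c) ≤ √√((0.85 ^ 2) ^ 2 * (b / c)) := by
        apply Real.sqrt_le_sqrt (Real.sqrt_le_sqrt _)
        convert h1 using 2
        norm_num
    _ = 0.85 * √√(b / c) := by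
        rw [Real.sqrt_mul (by positivity), Real.sqrt_sq (by positivity),
          Real.sqrt_mul (by positivity), Real.sqrt_sq (by norm_num)]

/-- Every connected weighted graph has a spanning tree of bounded `ℓ_q`-distortion, `q < 2`. -/
theorem exists_spanning_tree_distortion {q : ℝ} (hq : 0 < q) (hq2 : q < 2) :
    ∃ C : ℝ, 0 < C ∧ ∀ (V : Type) [Fintype V] (H : SimpleGraph V) (w : Sym2 V → ℝ),
      (∀ e ∈ H.edgeSet, 0 < w e) → H.Connected →
      ∃ T ≤ H, T.IsTree ∧
        ∑ p ∈ (univ : Finset V).offDiag, (wdist T w p.1 p.2 / wdist H w p.1 p.2) ^ q ≤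
          C * (Fintype.card V : ℝ) ^ 2 := by
  obtain ⟨β, C, C', hβ0, hβ1, hC, hC', hcut⟩ := exists_hasCheapCuts hq hq2
  have hβ : 0 < 1 - β := by linarith
  refine ⟨C / (1 - β) + C', by positivity, ?_⟩
  intro V _ H w hw hH
  have hV := hH.nonempty
  obtain ⟨x₀⟩ := hV
  have hN : (0 : ℝ) < Fintype.card V := by exact_mod_cast Fintype.card_pos_iff.2 ⟨x₀⟩
  have hcut' := hcut (wdist H w) (wdist_self hw)
  obtain ⟨T, hTH, hTc, hTr, τ, hτ, hsum⟩ := hasGoodTrees hw hH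
    (fun m hm => by
      have : (0 : ℝ) < m := by exact_mod_cast hm
      positivity)
    (fun m hm => by
      have : (m : ℝ) ≤ Fintype.card V := by exact_mod_cast hm
      rw [Real.sqrt_le_one, Real.sqrt_le_one]
      exact (div_le_one hN).2 this)
    (fun m n hmn => by
      have : (m : ℝ) ≤ n := by exact_mod_cast hmn
      apply Real.sqrt_le_sqrt (Real.sqrt_le_sqrt _)
      gcongr)
    (fun m n hmn => sqrt_sqrt_div_le (by positivity) hN.le (by exact_mod_cast hmn))
    (fun m => by positivity) hcut' univ x₀ (mem_univ _) (wdist H w x₀)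
    (∑ z, wdist H w x₀ z) (wdist_self hw x₀)
    (fun a _ b _ hab => wdist_le_add_of_adj hw (hH x₀ a) hab)
    (fun z _ hz => by
      obtain ⟨y, hy, -, he⟩ := exists_adj_wdist_eq hw (hH x₀ z) hz
      exact ⟨y, mem_univ _, hy, he⟩)
    (fun z _ => single_le_sum (fun z _ => wdist_nonneg hw x₀ z) (mem_univ z))
  have hwT : ∀ e ∈ T.edgeSet, 0 < w e := fun e he => hw e (SimpleGraph.edgeSet_mono hTH he)
  have hTconn : T.Connected := by
    refine (SimpleGraph.connected_iff _).2 ⟨fun a b => ?_, ⟨x₀⟩⟩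
    exact (hTr a (mem_univ _)).reachable.symm.trans (hTr b (mem_univ _)).reachable
  have hTtree : T.IsTree := by
    refine SimpleGraph.isTree_iff_connected_and_card.2 ⟨hTconn, ?_⟩
    have h1 := hTconn.card_vert_le_card_edgeSet_add_one
    have h2 : Nat.card T.edgeSet = T.edgeSet.ncard := rfl
    rw [card_univ, ← Nat.card_eq_fintype_card] at hTc
    omega
  refine ⟨T, hTH, hTtree, ?_⟩
  have halive : alivePairs (wdist H w) univ = (univ : Finset V).offDiag := by
    ext ⟨u, v⟩
    simp [alivePairs, BallInside]
  rw [halive] at hsum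
  calc ∑ p ∈ (univ : Finset V).offDiag, (wdist T w p.1 p.2 / wdist H w p.1 p.2) ^ q
      ≤ ∑ p ∈ (univ : Finset V).offDiag, (τ p.1 p.2 / wdist H w p.1 p.2) ^ q := by
        refine sum_le_sum fun p hp => ?_
        have hne := (mem_offDiag.1 hp).2.2
        have h1 := wdist_le_of_reachWithin hwT (hτ p.1 p.2 ⟨hne, fun _ _ => mem_univ _⟩)
        have h2 := wdist_nonneg hwT p.1 p.2
        have h3 := wdist_nonneg hw p.1 p.2
        gcongr
    _ ≤ _ := hsum
    _ ≤ C * ((Fintype.card V : ℝ) ^ 2 / (1 - β)) + C' * (Fintype.card V : ℝ) ^ 2 := by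
        apply add_le_add
        · rw [← mul_sum]
          refine mul_le_mul_of_nonneg_left ?_ hC.le
          refine le_trans ?_ (sum_ballCard_rpow_le hβ0 hβ1 (wdist H w))
          rw [← Fintype.sum_prod_type' (f := fun u v =>
            ((Fintype.card V : ℝ) / ballCard (wdist H w) u v) ^ β)]
          exact sum_le_sum_of_subset_of_nonneg (subset_univ _) fun _ _ _ => by positivity
        · rw [card_univ]
          have := Real.mul_self_sqrt hN.le
          apply le_of_eq
          rw [sq]
          linear_combination C' * (Fintype.card V : ℝ) * this
    _ = _ := by ring

end SpanningTree

section Assembly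

/-- A power of a product is bounded by the sum of two higher powers. -/
theorem rpow_mul_le_rpow_add_rpow {q s : ℝ} (hq : 0 < q) (hqs : q < s) {x y : ℝ} (hx : 0 ≤ x)
    (hy : 0 ≤ y) : (x * y) ^ q ≤ x ^ s + y ^ (q * (s / q).conjExponent) := by
  have h1 : 1 < s / q := (one_lt_div hq).2 hqs
  have hconj := Real.HolderConjugate.conjExponent h1
  have h2 : 1 ≤ (s / q).conjExponent := hconj.symm.lt.le
  have hy' := Real.young_inequality_of_nonneg (Real.rpow_nonneg hx q) (Real.rpow_nonneg hy q) hconj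
  rw [← Real.rpow_mul hx, ← Real.rpow_mul hy, mul_div_cancel₀ s hq.ne'] at hy'
  rw [Real.mul_rpow hx hy]
  refine hy'.trans (add_le_add ?_ ?_)
  · exact div_le_self (by positivity) h1.le
  · exact div_le_self (by positivity) h2

variable {V : Type*} [Fintype V] {G : SimpleGraph V} {w : Sym2 V → ℝ}

theorem exists_wWeight_le_mstWeight (hG : G.Connected) :
    ∃ T, IsSpanningTree G T ∧ wWeight T w ≤ mstWeight G w := by
  obtain ⟨T₀, hT₀, hT₀'⟩ := hG.exists_isTree_le
  have hfin : {x : ℝ | ∃ T : SimpleGraph V, IsSpanningTree G T ∧ x = wWeight T w}.Finite := by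
    refine (Set.finite_range fun T : SimpleGraph V => wWeight T w).subset ?_
    rintro x ⟨T, -, rfl⟩
    exact ⟨T, rfl⟩
  have hne : {x : ℝ | ∃ T : SimpleGraph V, IsSpanningTree G T ∧ x = wWeight T w}.Nonempty :=
    ⟨_, T₀, ⟨hT₀, hT₀'⟩, rfl⟩
  obtain ⟨T, hT, he⟩ := hne.csInf_mem hfin
  exact ⟨T, hT, he.symm.le⟩

theorem mstWeight_nonneg (hw : ∀ e ∈ G.edgeSet, 0 < w e) : 0 ≤ mstWeight G w := by
  apply Real.sInf_nonneg
  rintro x ⟨T, hT, rfl⟩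
  exact wWeight_nonneg fun e he => hw e (SimpleGraph.edgeSet_mono hT.1 he)

theorem exists_light_tree_distortion {q : ℝ} (hq : 1 ≤ q) (hq2 : q < 2) :
    ∃ C : ℝ, 0 < C ∧ ∀ (V : Type) [Fintype V] (G : SimpleGraph V) (w : Sym2 V → ℝ),
      (∀ e ∈ G.edgeSet, 0 < w e) → G.Connected → ∀ ρ : ℝ, 0 < ρ → ρ < 1 →
      ∃ T, IsSpanningTree G T ∧ wWeight T w ≤ (1 + ρ) * mstWeight G w ∧
        ∑ p ∈ (univ : Finset V).offDiag, (wdist T w p.1 p.2 / wdist G w p.1 p.2) ^ q ≤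
          C * (1 / ρ) ^ q * (Fintype.card V : ℝ) ^ 2 := by
  have hq0 : 0 < q := by linarith
  obtain ⟨s, hqs, hs2⟩ : ∃ s, q < s ∧ s < 2 := exists_between hq2
  obtain ⟨a, ha⟩ : ∃ a, a = q * (s / q).conjExponent := ⟨_, rfl⟩
  have ha0 : 0 < a := by
    have := (Real.HolderConjugate.conjExponent ((one_lt_div hq0).2 hqs)).symm.pos
    rw [ha]; positivity
  obtain ⟨C₁, hC₁, hlight⟩ := exists_light_spanner a ha0
  obtain ⟨C₂, hC₂, htree⟩ := exists_spanning_tree_distortion (by linarith : 0 < s) hs2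
  refine ⟨C₂ + C₁, by positivity, ?_⟩
  intro V _ G w hw hG ρ hρ hρ1
  obtain ⟨T₀, ⟨hT₀G, hT₀⟩, hT₀w⟩ := exists_wWeight_le_mstWeight (w := w) hG
  obtain ⟨w', hw'⟩ : ∃ w' : Sym2 V → ℝ, w' = fun e => if e ∈ T₀.edgeSet then w e else w e / ρ :=
    ⟨_, rfl⟩
  have hwle : ∀ e ∈ G.edgeSet, w e ≤ w' e := by
    intro e he
    have := hw e he
    rw [hw']; dsimp only
    split_ifs
    · exact le_rfl
    · rw [le_div_iff₀ hρ]; nlinarith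
  have hwge : ∀ e ∈ G.edgeSet, w' e ≤ w e / ρ := by
    intro e he
    have := hw e he
    rw [hw']; dsimp only
    split_ifs
    · rw [le_div_iff₀ hρ]; nlinarith
    · exact le_rfl
  have hw'pos : ∀ e ∈ G.edgeSet, 0 < w' e := fun e he => (hw e he).trans_le (hwle e he)
  obtain ⟨K, hKG, hKw, hKd⟩ := hlight V G T₀ w' hw'pos hG hT₀G hT₀.connected
  have hT₀w' : wWeight T₀ w' = wWeight T₀ w := by
    refine sum_congr rfl fun e he => ?_
    rw [hw']
    exact if_pos (by simpa using he)
  rw [hT₀w'] at hKw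
  have hHG : T₀ ⊔ K ≤ G := sup_le hT₀G hKG
  have hwH : ∀ e ∈ (T₀ ⊔ K).edgeSet, 0 < w e := fun e he => hw e (SimpleGraph.edgeSet_mono hHG he)
  have hw'H : ∀ e ∈ (T₀ ⊔ K).edgeSet, 0 < w' e := fun e he =>
    hw'pos e (SimpleGraph.edgeSet_mono hHG he)
  have hH : (T₀ ⊔ K).Connected := hT₀.connected.mono le_sup_left
  obtain ⟨T, hTH, hT, hTd⟩ := htree V (T₀ ⊔ K) w hwH hH
  refine ⟨T, ⟨hTH.trans hHG, hT⟩, ?_, ?_⟩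
  · have hweight : wWeight (T₀ ⊔ K) w ≤ wWeight T₀ w + ρ * wWeight K w' := by
      have hsub : (T₀ ⊔ K).edgeSet.toFinite.toFinset ⊆
          T₀.edgeSet.toFinite.toFinset ∪ (K.edgeSet.toFinite.toFinset \
            T₀.edgeSet.toFinite.toFinset) := by
        intro e he
        simp only [Set.Finite.mem_toFinset, SimpleGraph.edgeSet_sup, Set.mem_union, mem_union,
          mem_sdiff] at he ⊢
        tauto
      have hmem : ∀ e ∈ T₀.edgeSet.toFinite.toFinset ∪ (K.edgeSet.toFinite.toFinset \
            T₀.edgeSet.toFinite.toFinset), e ∈ G.edgeSet := by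
        intro e he
        simp only [Set.Finite.mem_toFinset, mem_union, mem_sdiff] at he
        exact he.elim (fun h => SimpleGraph.edgeSet_mono hT₀G h)
          (fun h => SimpleGraph.edgeSet_mono hKG h.1)
      calc wWeight (T₀ ⊔ K) w ≤ _ :=
            sum_le_sum_of_subset_of_nonneg hsub fun e he _ => (hw e (hmem e he)).le
        _ = wWeight T₀ w + ∑ e ∈ K.edgeSet.toFinite.toFinset \ T₀.edgeSet.toFinite.toFinset,
              w e := sum_union disjoint_sdiff
        _ ≤ wWeight T₀ w + ρ * wWeight K w' := by
            gcongr
            rw [wWeight, mul_sum]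
            calc _ = ∑ e ∈ K.edgeSet.toFinite.toFinset \ T₀.edgeSet.toFinite.toFinset,
                  ρ * w' e := by
                  refine sum_congr rfl fun e he => ?_
                  have he' : e ∉ T₀.edgeSet := by simpa using (mem_sdiff.1 he).2
                  rw [hw']; dsimp only
                  rw [if_neg he']
                  field_simp
              _ ≤ _ := by
                  refine sum_le_sum_of_subset_of_nonneg sdiff_subset fun e he _ => ?_
                  have := hw'pos e (SimpleGraph.edgeSet_mono hKG (by simpa using he))
                  positivity
    have h1 := wWeight_mono hwH hTH
    have h2 := mul_le_mul_of_nonneg_left (hKw.trans hT₀w) hρ.le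
    linarith
  · have hterm : ∀ p ∈ (univ : Finset V).offDiag,
        (wdist T w p.1 p.2 / wdist G w p.1 p.2) ^ q ≤ (1 / ρ) ^ q *
          ((wdist T w p.1 p.2 / wdist (T₀ ⊔ K) w p.1 p.2) ^ s +
            (wdist (T₀ ⊔ K) w' p.1 p.2 / wdist G w' p.1 p.2) ^ a) := by
      intro p hp
      have hne := (mem_offDiag.1 hp).2.2
      have hG0 := wdist_pos hw (hG p.1 p.2) hne
      have hG0' := wdist_pos hw'pos (hG p.1 p.2) hne
      have hH0 := wdist_pos hwH (hH p.1 p.2) hne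
      have hT0 := wdist_nonneg (fun e he => hwH e (SimpleGraph.edgeSet_mono hTH he)) p.1 p.2
      have h1 : wdist (T₀ ⊔ K) w p.1 p.2 ≤ wdist (T₀ ⊔ K) w' p.1 p.2 :=
        wdist_le_of_reachWithin hwH ((reachWithin_wdist hw'H (hH p.1 p.2)).mono_weight fun e he =>
          hwle e (SimpleGraph.edgeSet_mono hHG he))
      have h2 : wdist G w' p.1 p.2 ≤ wdist G w p.1 p.2 / ρ := by
        obtain ⟨W, hW⟩ := reachWithin_wdist hw (hG p.1 p.2)
        refine wdist_le_of_reachWithin hw'pos ⟨W, ?_⟩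
        rw [le_div_iff₀ hρ, ← List.sum_map_mul_right]
        refine le_trans (List.sum_le_sum fun e he => ?_) hW
        rw [← le_div_iff₀ hρ]
        exact hwge e (W.edges_subset_edgeSet he)
      rw [ha]
      have h3 := rpow_mul_le_rpow_add_rpow hq0 hqs
        (div_nonneg hT0 hH0.le) (div_nonneg (hH0.le.trans h1) hG0'.le)
      refine le_trans ?_ (mul_le_mul_of_nonneg_left h3 (by positivity))
      rw [← Real.mul_rpow (by positivity)
        (mul_nonneg (div_nonneg hT0 hH0.le) (div_nonneg (hH0.le.trans h1) hG0'.le))]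
      apply Real.rpow_le_rpow (div_nonneg hT0 hG0.le) _ hq0.le
      rw [le_div_iff₀ hρ] at h2
      have hH0' := hH0.le.trans h1
      calc wdist T w p.1 p.2 / wdist G w p.1 p.2
          = wdist T w p.1 p.2 / wdist (T₀ ⊔ K) w p.1 p.2 *
            (wdist (T₀ ⊔ K) w p.1 p.2 / wdist G w p.1 p.2) := by field_simp
        _ ≤ wdist T w p.1 p.2 / wdist (T₀ ⊔ K) w p.1 p.2 *
            (wdist (T₀ ⊔ K) w' p.1 p.2 / (wdist G w' p.1 p.2 * ρ)) := by gcongr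
        _ = _ := by field_simp
    refine (sum_le_sum hterm).trans ?_
    rw [← mul_sum, sum_add_distrib]
    have := mul_le_mul_of_nonneg_left (add_le_add hTd hKd) (by positivity : 0 ≤ (1 / ρ) ^ q)
    linarith

end Assembly

/-- For every `1 ≤ q < 2` there is a constant `C_q > 0` such that every
weighted graph `G` on at least two vertices and every `0 < ρ < 1` admit a spanning tree
`T` of lightness at most `1 + ρ` with `ℓ_q`-distortion at most `C_q/ρ`. -/
theorem stmt2 (q : ℝ) (hq1 : 1 ≤ q) (hq2 : q < 2) :
    ∃ C : ℝ, 0 < C ∧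
      ∀ (V : Type) [Fintype V] (G : SimpleGraph V) (w : Sym2 V → ℝ),
        IsWeightedGraph G w → 2 ≤ Fintype.card V →
        ∀ ρ : ℝ, 0 < ρ → ρ < 1 →
          ∃ T : SimpleGraph V, IsSpanningTree G T ∧
            wWeight T w / mstWeight G w ≤ 1 + ρ ∧
            distq G T w q ≤ C / ρ := by
  obtain ⟨C, hC, h⟩ := exists_light_tree_distortion hq1 hq2
  refine ⟨(2 * C) ^ (1 / q), by positivity, ?_⟩
  intro V _ G w hG hV ρ hρ hρ1
  obtain ⟨T, hT, hTw, hTd⟩ := h V G w hG.2.1 hG.1 ρ hρ hρ1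
  refine ⟨T, hT, div_le_of_le_mul₀ (mstWeight_nonneg hG.2.1) (by linarith) hTw, ?_⟩
  have hq0 : 0 < q := by linarith
  have hN : (2 : ℝ) ≤ Fintype.card V := by exact_mod_cast hV
  have hwT : ∀ e ∈ T.edgeSet, 0 < w e := fun e he =>
    hG.2.1 e (SimpleGraph.edgeSet_mono hT.1 he)
  have hNN : (0 : ℝ) < Fintype.card V * (Fintype.card V - 1) := by nlinarith
  have key : (∑ p ∈ (univ : Finset V).offDiag, (wdist T w p.1 p.2 / wdist G w p.1 p.2) ^ q) /
      ((Fintype.card V : ℝ) * ((Fintype.card V : ℝ) - 1)) ≤ 2 * C * (1 / ρ) ^ q := by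
    rw [div_le_iff₀ hNN]
    have h1 : (Fintype.card V : ℝ) ^ 2 ≤ 2 * (Fintype.card V * (Fintype.card V - 1)) := by nlinarith
    have h2 : 0 ≤ C * (1 / ρ) ^ q := by positivity
    nlinarith [mul_le_mul_of_nonneg_left h1 h2]
  calc distq G T w q ≤ (2 * C * (1 / ρ) ^ q) ^ (1 / q) := by
        refine Real.rpow_le_rpow (div_nonneg (sum_nonneg fun p _ => Real.rpow_nonneg
          (div_nonneg (wdist_nonneg hwT _ _) (wdist_nonneg hG.2.1 _ _)) _) hNN.le) key
          (by positivity)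
    _ = (2 * C) ^ (1 / q) / ρ := by
        rw [Real.mul_rpow (by positivity) (by positivity), ← Real.rpow_mul (by positivity),
          mul_one_div_cancel hq0.ne', Real.rpow_one, mul_one_div]
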